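/- arXiv:math/9812151 — 10 statements merged into one kernel-verified Lean document; each statement's English description precedes it below -/
import Mathlib

section
/- Let H be a Hopf algebra over a field k with bijective antipode, and suppose exp(H) = n is finite. Then for every positive integer r, the identity m_r ∘ (id ⊗ S^{-2} ⊗ S^{-4} ⊗ ⋯ ⊗ S^{-2r+2}) ∘ Δ_r = ε(·)1 holds if and only if n divides r. -/
open TensorProduct

noncomputable section

variable (k H : Type*) [CommSemiring k] [Semiring H] [Bialgebra k H]

/-- Convolution product of two linear endomorphisms of a bialgebra:
`(f ⋆ g)(x) = ∑ f(x⁽¹⁾) g(x⁽²⁾)`, i.e. `m ∘ (f ⊗ g) ∘ Δ`. -/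
def conv (f g : H →ₗ[k] H) : H →ₗ[k] H :=
  LinearMap.mul' k H ∘ₗ TensorProduct.map f g ∘ₗ Coalgebra.comul

/-- `expMap k H Sinv n` is the map `m_n ∘ (id ⊗ Sinv² ⊗ Sinv⁴ ⊗ ⋯ ⊗ Sinv^{2n-2}) ∘ Δ_n`
(defined by the recursion `m_1 = Δ_1 = id`, `m_n = m ∘ (m_{n-1} ⊗ id)`,
`Δ_n = (Δ_{n-1} ⊗ id) ∘ Δ`). -/
def expMap (Sinv : H →ₗ[k] H) : ℕ → (H →ₗ[k] H)
  | 0 => 0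
  | 1 => LinearMap.id
  | (n+2) => conv k H (expMap Sinv (n+1)) ((Sinv ∘ₗ Sinv) ^ (n+1))

/-- The map `x ↦ ε(x)·1`. -/
def counitUnit : H →ₗ[k] H := Algebra.linearMap k H ∘ₗ Coalgebra.counit

/-- The exponent of a Hopf algebra (with `Sinv` the inverse of the antipode):
the least `n > 0` with `m_n ∘ (id ⊗ S⁻² ⊗ ⋯ ⊗ S^{-2n+2}) ∘ Δ_n = ε(·)1`.
By convention `hopfExponent = 0` when no such `n` exists (i.e. `exp(H) = ∞`). -/
def hopfExponent (Sinv : H →ₗ[k] H) : ℕ :=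
  sInf {n : ℕ | 0 < n ∧ expMap k H Sinv n = counitUnit k H}

section Helpers

open WithConv

theorem conv_eq_mul {k H : Type*} [CommSemiring k] [Semiring H] [Bialgebra k H]
    (f g : H →ₗ[k] H) : conv k H f g = (toConv f * toConv g).ofConv := rfl

theorem counitUnit_eq_one {k H : Type*} [CommSemiring k] [Semiring H] [Bialgebra k H] :
    counitUnit k H = (1 : WithConv (H →ₗ[k] H)).ofConv := rfl

theorem conv_one_left {k H : Type*} [CommSemiring k] [Semiring H] [Bialgebra k H]
    (f : H →ₗ[k] H) : conv k H (counitUnit k H) f = f := by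
  rw [conv_eq_mul, counitUnit_eq_one, toConv_ofConv, one_mul, ofConv_toConv]

theorem conv_assoc' {k H : Type*} [CommSemiring k] [Semiring H] [Bialgebra k H]
    (f g h : H →ₗ[k] H) : conv k H (conv k H f g) h = conv k H f (conv k H g h) := by
  simp only [conv_eq_mul, toConv_ofConv, mul_assoc]

theorem algHom_comp_conv {k H : Type*} [CommSemiring k] [Semiring H] [Bialgebra k H]
    (t : H →ₐ[k] H) (f g : H →ₗ[k] H) :
    t.toLinearMap ∘ₗ conv k H f g = conv k H (t.toLinearMap ∘ₗ f) (t.toLinearMap ∘ₗ g) :=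
  LinearMap.algHom_comp_convMul_distrib t (toConv f) (toConv g)

theorem expMap_add {k H : Type*} [CommSemiring k] [Semiring H] [Bialgebra k H]
    (Sinv : H →ₗ[k] H) (t : ℕ → (H →ₐ[k] H))
    (ht : ∀ a, (t a).toLinearMap = (Sinv ∘ₗ Sinv) ^ a) (a b : ℕ) :
    expMap k H Sinv ((a + 1) + (b + 1)) =
      conv k H (expMap k H Sinv (a + 1)) ((t (a + 1)).toLinearMap ∘ₗ expMap k H Sinv (b + 1)) := by
  induction b with
  | zero =>
    rw [ht]
    rfl
  | succ b ih =>
    have h1 : expMap k H Sinv ((a + 1) + (b + 1 + 1)) =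
        conv k H (expMap k H Sinv ((a + 1) + (b + 1))) ((Sinv ∘ₗ Sinv) ^ ((a + 1) + (b + 1))) := by
      rw [show (a + 1) + (b + 1 + 1) = (a + 1 + b) + 2 by omega]
      rfl
    have h2 : expMap k H Sinv (b + 1 + 1) =
        conv k H (expMap k H Sinv (b + 1)) ((Sinv ∘ₗ Sinv) ^ (b + 1)) := rfl
    rw [h1, ih, h2, conv_assoc', algHom_comp_conv, ht, pow_add _ (a + 1) (b + 1)]
    rfl

end Helpers

/-- If `exp(H) = n < ∞` then, for every positive integer `r`,
`m_r ∘ (id ⊗ S⁻² ⊗ ⋯ ⊗ S^{-2r+2}) ∘ Δ_r = ε(·)1` holds iff `n ∣ r`. -/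
theorem expMap_eq_counitUnit_iff_dvd {k H : Type*} [Field k] [Ring H] [HopfAlgebra k H]
    (Sinv : H →ₗ[k] H)
    (hS1 : Sinv ∘ₗ HopfAlgebra.antipode (R := k) (A := H) = LinearMap.id)
    (hS2 : HopfAlgebra.antipode (R := k) (A := H) ∘ₗ Sinv = LinearMap.id)
    (n : ℕ) (hn : 0 < n) (hexp : hopfExponent k H Sinv = n)
    (r : ℕ) (hr : 0 < r) :
    expMap k H Sinv r = counitUnit k H ↔ n ∣ r := by
  have h12 : ∀ x, Sinv (HopfAlgebra.antipode k x) = x := fun x => LinearMap.congr_fun hS1 x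
  have h21 : ∀ x, HopfAlgebra.antipode k (Sinv x) = x := fun x => LinearMap.congr_fun hS2 x
  have hinj : Function.Injective Sinv := Function.LeftInverse.injective h21
  have hone : Sinv 1 = 1 := by
    have := h12 1
    rwa [HopfAlgebra.antipode_one] at this
  have hmul : ∀ x y, Sinv (x * y) = Sinv y * Sinv x := fun x y => by
    rw [← h12 (Sinv y * Sinv x), HopfAlgebra.antipode_mul_antidistrib, h21, h21]
  let T : H →ₐ[k] H := AlgHom.ofLinearMap (Sinv ∘ₗ Sinv) (by simp [hone])
    (fun x y => by simp [hmul])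
  have hTinj : Function.Injective T := hinj.comp hinj
  have hT : ∀ a : ℕ, (T ^ a).toLinearMap = (Sinv ∘ₗ Sinv) ^ a := by
    intro a
    induction a with
    | zero => rfl
    | succ a ih => rw [pow_succ, pow_succ, ← ih]; rfl
  have hTainj : ∀ a : ℕ, Function.Injective (T ^ a) := by
    intro a
    induction a with
    | zero => exact Function.injective_id
    | succ a ih => rw [pow_succ]; exact ih.comp hTinj
  have hu : ∀ a : ℕ, (T ^ a).toLinearMap ∘ₗ counitUnit k H = counitUnit k H := by
    intro a
    ext x
    exact (T ^ a).commutes _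
  have hmem : n ∈ {n : ℕ | 0 < n ∧ expMap k H Sinv n = counitUnit k H} := by
    have hne : {n : ℕ | 0 < n ∧ expMap k H Sinv n = counitUnit k H}.Nonempty := by
      by_contra hne
      rw [Set.not_nonempty_iff_eq_empty] at hne
      rw [hopfExponent, hne, Nat.sInf_empty] at hexp
      omega
    have := Nat.sInf_mem hne
    rwa [← hopfExponent, hexp] at this
  have hmin : ∀ m, 0 < m → expMap k H Sinv m = counitUnit k H → n ≤ m := by
    intro m h0 h
    rw [← hexp]
    exact Nat.sInf_le ⟨h0, h⟩
  have hstep : ∀ m, 0 < m →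
      (expMap k H Sinv (n + m) = counitUnit k H ↔ expMap k H Sinv m = counitUnit k H) := by
    intro m h0
    have hE := hmem.2
    obtain ⟨a, rfl⟩ : ∃ a, n = a + 1 := ⟨n - 1, by omega⟩
    obtain ⟨b, rfl⟩ : ∃ b, m = b + 1 := ⟨m - 1, by omega⟩
    rw [expMap_add Sinv (fun a => T ^ a) hT, hE, conv_one_left]
    constructor
    · intro h
      rw [← hu (a + 1)] at h
      ext x
      exact hTainj (a + 1) (LinearMap.congr_fun h x)
    · intro h
      rw [h, hu]
  induction r using Nat.strong_induction_on with
  | _ r ih =>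
    rcases lt_trichotomy r n with h | h | h
    · constructor
      · intro h'
        have := hmin r hr h'
        omega
      · intro h'
        have := Nat.le_of_dvd hr h'
        omega
    · subst h
      simp [hmem.2]
    · obtain ⟨m, rfl⟩ : ∃ m, r = n + m := ⟨r - n, by omega⟩
      have h3 := ih m (by omega) (by omega)
      exact (hstep m (by omega)).trans (h3.trans (Nat.dvd_add_right (dvd_refl n)).symm)

end
end

section
/- Let H and B be finite-dimensional Hopf algebras over a field k with bijective antipodes, and let ⟨·,·⟩ : B × H → k be a nondegenerate bilinear pairing satisfying ⟨ab, x⟩ = Σ ⟨a, x_{(1)}⟩⟨b, x_{(2)}⟩, ⟨a, xy⟩ = Σ ⟨a_{(1)}, x⟩⟨a_{(2)}, y⟩, ⟨1_B, x⟩ = ε_H(x), and ⟨a, 1_H⟩ = ε_B(a) for all a, b ∈ B and x, y ∈ H (so that B is isomorphic to the dual Hopf algebra H*). Then exp(B) = exp(H). -/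
open TensorProduct

noncomputable section

variable (k H : Type*) [CommSemiring k] [Semiring H] [Bialgebra k H]

theorem conv_adj_aux {k B H : Type*} [Field k]
    [Ring B] [HopfAlgebra k B] [Ring H] [HopfAlgebra k H]
    (p : B →ₗ[k] H →ₗ[k] k)
    (hmul : ∀ (a b : B) (x : H), p (a * b) x
      = (LinearMap.mul' k k ∘ₗ TensorProduct.map (p a) (p b)) (Coalgebra.comul (R := k) x))
    (hcomul : ∀ (a : B) (x y : H), p a (x * y)
      = (LinearMap.mul' k k ∘ₗ TensorProduct.map (p.flip x) (p.flip y))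
          (Coalgebra.comul (R := k) a))
    (f g : B →ₗ[k] B) (f' g' : H →ₗ[k] H)
    (hf : ∀ a x, p (f a) x = p a (f' x)) (hg : ∀ a x, p (g a) x = p a (g' x))
    (a : B) (x : H) : p (conv k B f g a) x = p a (conv k H f' g' x) := by
  have ra := Coalgebra.Repr.arbitrary k a
  have rx := Coalgebra.Repr.arbitrary k x
  have h1 : conv k B f g a = ∑ i ∈ ra.index, f (ra.left i) * g (ra.right i) := by
    simp [conv, ← ra.eq]
  have h2 : conv k H f' g' x = ∑ i ∈ rx.index, f' (rx.left i) * g' (rx.right i) := by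
    simp [conv, ← rx.eq]
  rw [h1, h2]
  simp only [map_sum, LinearMap.sum_apply, hmul, hcomul]
  rw [← ra.eq, ← rx.eq]
  simp only [map_sum, LinearMap.comp_apply, TensorProduct.map_tmul, LinearMap.mul'_apply,
    LinearMap.flip_apply, hf, hg]
  exact Finset.sum_comm

theorem counitUnit_adj_aux {k B H : Type*} [Field k]
    [Ring B] [HopfAlgebra k B] [Ring H] [HopfAlgebra k H]
    (p : B →ₗ[k] H →ₗ[k] k)
    (hone : ∀ x : H, p 1 x = Coalgebra.counit (R := k) x)
    (hcounit : ∀ a : B, p a 1 = Coalgebra.counit (R := k) a)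
    (a : B) (x : H) : p (counitUnit k B a) x = p a (counitUnit k H x) := by
  simp [counitUnit, Algebra.algebraMap_eq_smul_one, hone, hcounit, mul_comm]

theorem antipode_unique_aux {k B : Type*} [Field k] [Ring B] [HopfAlgebra k B]
    (T : B →ₗ[k] B) (hT : conv k B T LinearMap.id = counitUnit k B) :
    T = HopfAlgebra.antipode (R := k) (A := B) := by
  apply WithConv.toConv_injective
  refine left_inv_eq_right_inv (a := WithConv.toConv LinearMap.id) ?_ LinearMap.id_mul_antipode
  exact congrArg WithConv.toConv hT

theorem conv_antipode_aux {k B : Type*} [Field k] [Ring B] [HopfAlgebra k B] :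
    conv k B (HopfAlgebra.antipode (R := k) (A := B)) LinearMap.id = counitUnit k B :=
  congrArg WithConv.ofConv (LinearMap.antipode_mul_id (R := k) (C := B))

/-- If `B` and `H` are finite-dimensional Hopf algebras with bijective antipodes and
`⟨·,·⟩ : B × H → k` is a nondegenerate bilinear pairing with
`⟨ab, x⟩ = ∑ ⟨a, x⁽¹⁾⟩⟨b, x⁽²⁾⟩`, `⟨a, xy⟩ = ∑ ⟨a⁽¹⁾, x⟩⟨a⁽²⁾, y⟩`, `⟨1, x⟩ = ε(x)` and
`⟨a, 1⟩ = ε(a)` (so `B ≅ H*`), then `exp(B) = exp(H)`. -/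
theorem hopfExponent_dual {k B H : Type*} [Field k]
    [Ring B] [HopfAlgebra k B] [FiniteDimensional k B]
    [Ring H] [HopfAlgebra k H] [FiniteDimensional k H]
    (SinvB : B →ₗ[k] B)
    (hS1B : SinvB ∘ₗ HopfAlgebra.antipode (R := k) (A := B) = LinearMap.id)
    (hS2B : HopfAlgebra.antipode (R := k) (A := B) ∘ₗ SinvB = LinearMap.id)
    (SinvH : H →ₗ[k] H)
    (hS1H : SinvH ∘ₗ HopfAlgebra.antipode (R := k) (A := H) = LinearMap.id)
    (hS2H : HopfAlgebra.antipode (R := k) (A := H) ∘ₗ SinvH = LinearMap.id)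
    (p : B →ₗ[k] H →ₗ[k] k)
    -- nondegeneracy
    (hpB : ∀ a : B, (∀ x : H, p a x = 0) → a = 0)
    (hpH : ∀ x : H, (∀ a : B, p a x = 0) → x = 0)
    -- `⟨ab, x⟩ = ∑ ⟨a, x⁽¹⁾⟩ ⟨b, x⁽²⁾⟩`
    (hmul : ∀ (a b : B) (x : H), p (a * b) x
      = (LinearMap.mul' k k ∘ₗ TensorProduct.map (p a) (p b)) (Coalgebra.comul (R := k) x))
    -- `⟨a, xy⟩ = ∑ ⟨a⁽¹⁾, x⟩ ⟨a⁽²⁾, y⟩`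
    (hcomul : ∀ (a : B) (x y : H), p a (x * y)
      = (LinearMap.mul' k k ∘ₗ TensorProduct.map (p.flip x) (p.flip y))
          (Coalgebra.comul (R := k) a))
    -- `⟨1, x⟩ = ε(x)`
    (hone : ∀ x : H, p 1 x = Coalgebra.counit (R := k) x)
    -- `⟨a, 1⟩ = ε(a)`
    (hcounit : ∀ a : B, p a 1 = Coalgebra.counit (R := k) a) :
    hopfExponent k B SinvB = hopfExponent k H SinvH := by
  have adj_ext : ∀ (f g : B →ₗ[k] B) (f' g' : H →ₗ[k] H),
      (∀ a x, p (f a) x = p a (f' x)) → (∀ a x, p (g a) x = p a (g' x)) →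
      (f = g ↔ f' = g') := by
    intro f g f' g' hf hg
    constructor
    · rintro rfl
      ext x
      refine sub_eq_zero.1 (hpH _ fun a => ?_)
      rw [map_sub, ← hf, ← hg, sub_self]
    · rintro rfl
      ext a
      refine sub_eq_zero.1 (hpB _ fun x => ?_)
      rw [map_sub, LinearMap.sub_apply, hf, hg, sub_self]
  have hpp : p.IsPerfPair := by
    apply LinearMap.IsPerfPair.of_injective
    · rw [injective_iff_map_eq_zero]
      intro a ha
      exact hpB a fun x => by simp [ha]
    · rw [injective_iff_map_eq_zero]
      intro x hx
      exact hpH x fun a => by simpa using congrArg (fun q => q a) hx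
  let T : B →ₗ[k] B := p.toPerfPair.symm.toLinearMap ∘ₗ
    (HopfAlgebra.antipode (R := k) (A := H)).dualMap ∘ₗ p
  have hT : ∀ a x, p (T a) x = p a (HopfAlgebra.antipode (R := k) (A := H) x) := by
    intro a x
    have : p (T a) = (HopfAlgebra.antipode (R := k) (A := H)).dualMap (p a) :=
      p.toPerfPair.apply_symm_apply _
    rw [this]; rfl
  have hTS : T = HopfAlgebra.antipode (R := k) (A := B) := by
    apply antipode_unique_aux
    exact (adj_ext _ _ _ _
      (conv_adj_aux p hmul hcomul T LinearMap.id _ LinearMap.id hT (fun _ _ => rfl))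
      (counitUnit_adj_aux p hone hcounit)).2 conv_antipode_aux
  rw [hTS] at hT
  have hSi : ∀ a x, p (SinvB a) x = p a (SinvH x) := by
    intro a x
    have e1 : HopfAlgebra.antipode (R := k) (A := H) (SinvH x) = x := LinearMap.congr_fun hS2H x
    have e2 : HopfAlgebra.antipode (R := k) (A := B) (SinvB a) = a := LinearMap.congr_fun hS2B a
    conv_lhs => rw [← e1]
    rw [← hT, e2]
  have hpow : ∀ (n : ℕ) a x, p (((SinvB ∘ₗ SinvB) ^ n) a) x = p a (((SinvH ∘ₗ SinvH) ^ n) x) := by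
    intro n
    induction n with
    | zero => intro a x; rfl
    | succ n ih =>
      intro a x
      rw [pow_succ, pow_succ']
      simp only [Module.End.mul_apply, LinearMap.comp_apply, ih, hSi]
  have hexp : ∀ (n : ℕ) a x, p (expMap k B SinvB (n+1) a) x = p a (expMap k H SinvH (n+1) x) := by
    intro n
    induction n with
    | zero => intro a x; rfl
    | succ n ih =>
      exact conv_adj_aux p hmul hcomul _ _ _ _ ih (hpow (n+1))
  unfold hopfExponent
  congr 1
  ext n
  cases n with
  | zero => simp
  | succ n =>
    exact and_congr Iff.rfl
      (adj_ext _ _ _ _ (hexp n) (counitUnit_adj_aux p hone hcounit))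

end
end

section
/- Let H₁ and H₂ be Hopf algebras over a field k with bijective antipodes, and give H₁ ⊗_k H₂ its standard Hopf algebra structure (componentwise multiplication, comultiplication Δ(x ⊗ y) = Σ (x_{(1)} ⊗ y_{(1)}) ⊗ (x_{(2)} ⊗ y_{(2)}), antipode S₁ ⊗ S₂). Then exp(H₁ ⊗_k H₂) equals the least common multiple of exp(H₁) and exp(H₂); in particular exp(H₁ ⊗ H₂) is finite if and only if both exp(H₁) and exp(H₂) are finite. -/
open TensorProduct

noncomputable section

variable (k H : Type*) [CommSemiring k] [Semiring H] [Bialgebra k H]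

open WithConv in
/-- Auxiliary sequence with the right value at zero. -/
def expAux {R A : Type*} [CommSemiring R] [Semiring A] [Bialgebra R A] (T : A →ₗ[R] A) :
    ℕ → WithConv (A →ₗ[R] A)
  | 0 => 1
  | (n+1) => expAux T n * toConv (T ^ n)

theorem expMap_eq_expAux {R A : Type*} [CommSemiring R] [Semiring A] [Bialgebra R A]
    (S : A →ₗ[R] A) (n : ℕ) :
    expMap R A S (n + 1) = (expAux (S ∘ₗ S) (n + 1)).ofConv := by
  induction n with
  | zero => simp [expMap, expAux]; rfl
  | succ n ih =>
    rw [expMap, ih, expAux]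
    rfl

theorem exists_algHom_pow {R A : Type*} [CommSemiring R] [Semiring A] [Algebra R A]
    (T : A →ₗ[R] A) (h1 : T 1 = 1) (hm : ∀ a b, T (a * b) = T a * T b) (n : ℕ) :
    ∃ φ : A →ₐ[R] A, φ.toLinearMap = T ^ n := by
  induction n with
  | zero => exact ⟨AlgHom.id R A, rfl⟩
  | succ n ih =>
    obtain ⟨φ, hφ⟩ := ih
    refine ⟨φ.comp (AlgHom.ofLinearMap T h1 hm), ?_⟩
    rw [pow_succ, ← hφ]
    rfl

open WithConv in
theorem expAux_add {R A : Type*} [CommSemiring R] [Semiring A] [Bialgebra R A]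
    (T : A →ₗ[R] A) (h1 : T 1 = 1) (hm : ∀ a b, T (a * b) = T a * T b) (n m : ℕ) :
    expAux T (n + m) = expAux T n * toConv ((T ^ n) ∘ₗ (expAux T m).ofConv) := by
  obtain ⟨φ, hφ⟩ := exists_algHom_pow T h1 hm n
  induction m with
  | zero =>
    have : toConv ((T ^ n) ∘ₗ (expAux T 0).ofConv) = 1 := by
      rw [← hφ]
      ext x
      simp [expAux]
    rw [this, mul_one, add_zero]
  | succ m ih =>
    rw [← add_assoc, expAux, ih, expAux, ← hφ, LinearMap.algHom_comp_convMul_distrib, hφ, mul_assoc,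
      pow_add]
    rfl

theorem expAux_dvd {R A : Type*} [CommSemiring R] [Semiring A] [Bialgebra R A]
    (T : A →ₗ[R] A) (h1 : T 1 = 1) (hm : ∀ a b, T (a * b) = T a * T b)
    (hinj : Function.Injective T) (n m : ℕ) (hn : expAux T n = 1) :
    expAux T (n + m) = 1 ↔ expAux T m = 1 := by
  rw [expAux_add T h1 hm, hn, one_mul]
  have hT : (T ^ n) 1 = 1 := by
    obtain ⟨φ, hφ⟩ := exists_algHom_pow T h1 hm n
    rw [← hφ]; simp
  have hi : Function.Injective (T ^ n) := by
    rw [Module.End.coe_pow]; exact hinj.iterate n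
  have key : (T ^ n) ∘ₗ (1 : WithConv (A →ₗ[R] A)).ofConv = (1 : WithConv (A →ₗ[R] A)).ofConv := by
    ext x
    simp [LinearMap.convOne_def, Algebra.algebraMap_eq_smul_one, hT]
  constructor
  · intro h
    have h' := congrArg WithConv.ofConv h
    apply WithConv.ofConv_injective
    rw [← key] at h'
    ext x
    exact hi (LinearMap.congr_fun h' x)
  · intro h
    rw [h, key]

theorem mem_iff_sInf_dvd (P : ℕ → Prop) (h0 : P 0) (hP : ∀ n m, P n → (P (n + m) ↔ P m)) (n : ℕ) :
    P n ↔ sInf {n : ℕ | 0 < n ∧ P n} ∣ n := by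
  set d := sInf {n : ℕ | 0 < n ∧ P n} with hd
  have hmul : P d → ∀ q r, P (d * q + r) ↔ P r := by
    intro h q r
    induction q with
    | zero => simp
    | succ q ih => rw [← ih, mul_add, mul_one, add_comm (d * q), add_assoc, hP d _ h]
  by_cases hne : {n : ℕ | 0 < n ∧ P n}.Nonempty
  · have hmem : 0 < d ∧ P d := Nat.sInf_mem hne
    have h2 := hmul hmem.2 (n / d) (n % d)
    rw [Nat.div_add_mod] at h2
    rw [h2]
    constructor
    · intro h
      by_contra hc
      have hpos : 0 < n % d := Nat.pos_of_ne_zero fun h => hc (Nat.dvd_of_mod_eq_zero h)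
      have : d ≤ n % d := Nat.sInf_le ⟨hpos, h⟩
      exact absurd (Nat.mod_lt n hmem.1) (by omega)
    · intro h
      rw [Nat.mod_eq_zero_of_dvd h]; exact h0
  · have hz : d = 0 := by
      rw [hd, Set.not_nonempty_iff_eq_empty.mp hne, Nat.sInf_empty]
    rw [hz, zero_dvd_iff]
    constructor
    · intro h
      by_contra hc
      exact hne ⟨n, Nat.pos_of_ne_zero hc, h⟩
    · rintro rfl; exact h0

theorem hopfExponent_eq {R A : Type*} [CommSemiring R] [Semiring A] [Bialgebra R A]
    (S : A →ₗ[R] A) :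
    hopfExponent R A S = sInf {n : ℕ | 0 < n ∧ expAux (S ∘ₗ S) n = 1} := by
  unfold hopfExponent
  congr 1
  ext n
  cases n with
  | zero => simp
  | succ n =>
    simp only [Set.mem_setOf_eq, expMap_eq_expAux]
    refine and_congr_right fun _ => ?_
    exact (WithConv.ofConv_injective.eq_iff (b := (1 : WithConv (A →ₗ[R] A))))

theorem sq_props {R A : Type*} [CommSemiring R] [Semiring A] [HopfAlgebra R A]
    (S : A →ₗ[R] A)
    (h1 : S ∘ₗ HopfAlgebra.antipode (R := R) (A := A) = LinearMap.id)
    (h2 : HopfAlgebra.antipode (R := R) (A := A) ∘ₗ S = LinearMap.id) :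
    (S ∘ₗ S) 1 = 1 ∧ (∀ a b, (S ∘ₗ S) (a * b) = (S ∘ₗ S) a * (S ∘ₗ S) b) ∧
      Function.Injective (S ∘ₗ S) := by
  have h1' : ∀ x, S (HopfAlgebra.antipode R x) = x := LinearMap.congr_fun h1
  have h2' : ∀ x, HopfAlgebra.antipode R (S x) = x := LinearMap.congr_fun h2
  have hone : S 1 = 1 := by
    conv_lhs => rw [← HopfAlgebra.antipode_one (R := R) (A := A)]
    exact h1' 1
  have hi : Function.Injective S := Function.LeftInverse.injective h2'
  have hm : ∀ a b, S (a * b) = S b * S a := by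
    intro a b
    conv_lhs => rw [← h2' a, ← h2' b, ← HopfAlgebra.antipode_mul_antidistrib, h1']
  refine ⟨by simp [hone], fun a b => by simp [hm], ?_⟩
  exact hi.comp hi

theorem hopfExponent_dvd {R A : Type*} [CommSemiring R] [Semiring A] [HopfAlgebra R A]
    (S : A →ₗ[R] A)
    (h1 : S ∘ₗ HopfAlgebra.antipode (R := R) (A := A) = LinearMap.id)
    (h2 : HopfAlgebra.antipode (R := R) (A := A) ∘ₗ S = LinearMap.id) (n : ℕ) :
    expAux (S ∘ₗ S) n = 1 ↔ hopfExponent R A S ∣ n := by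
  obtain ⟨ha, hb, hc⟩ := sq_props S h1 h2
  rw [hopfExponent_eq]
  exact mem_iff_sInf_dvd (fun n => expAux (S ∘ₗ S) n = 1) rfl (expAux_dvd _ ha hb hc) n

open WithConv in
theorem expAux_tensor {R A B : Type*} [CommSemiring R] [Semiring A] [Bialgebra R A]
    [Semiring B] [Bialgebra R B] (T : A →ₗ[R] A) (U : B →ₗ[R] B) (n : ℕ) :
    expAux (TensorProduct.map T U) n
      = toConv (TensorProduct.map (expAux T n).ofConv (expAux U n).ofConv) := by
  induction n with
  | zero =>
    apply WithConv.ofConv_injective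
    refine TensorProduct.ext' fun x y => ?_
    simp [expAux, LinearMap.convOne_def, Algebra.algebraMap_eq_smul_one, TensorProduct.smul_tmul',
      TensorProduct.tmul_smul, Algebra.TensorProduct.one_def, mul_smul]
  | succ n ih =>
    rw [expAux, ih, TensorProduct.map_pow]
    exact TensorProduct.map_convMul_map (f := expAux T n) (g := expAux U n)
      (h := toConv (T ^ n)) (k := toConv (U ^ n))

theorem expAux_one {R A : Type*} [CommSemiring R] [Semiring A] [Bialgebra R A]
    (T : A →ₗ[R] A) (h1 : T 1 = 1) (n : ℕ) : (expAux T n).ofConv 1 = 1 := by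
  induction n with
  | zero => simp [expAux, LinearMap.convOne_def]
  | succ n ih =>
    have : (T ^ n) 1 = 1 := by
      rw [Module.End.coe_pow]; exact Function.iterate_fixed h1 n
    simp [expAux, LinearMap.convMul_def, Algebra.TensorProduct.one_def, ih, this]

theorem expAux_tensor_iff {R A B : Type*} [CommSemiring R] [Semiring A] [Bialgebra R A]
    [Semiring B] [Bialgebra R B] (T : A →ₗ[R] A) (U : B →ₗ[R] B)
    (hT : T 1 = 1) (hU : U 1 = 1) (n : ℕ) :
    expAux (TensorProduct.map T U) n = 1 ↔ expAux T n = 1 ∧ expAux U n = 1 := by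
  have h0 := expAux_tensor T U 0
  constructor
  · intro h
    rw [expAux_tensor] at h
    have hx : ∀ x y, (expAux T n).ofConv x ⊗ₜ[R] (expAux U n).ofConv y
        = (Coalgebra.counit (R := R) (x ⊗ₜ[R] y)) • ((1 : A) ⊗ₜ[R] (1 : B)) := by
      intro x y
      have := LinearMap.congr_fun (congrArg WithConv.ofConv h) (x ⊗ₜ[R] y)
      simpa [LinearMap.convOne_def, Algebra.algebraMap_eq_smul_one,
        Algebra.TensorProduct.one_def] using this
    constructor
    · apply WithConv.ofConv_injective
      ext x
      have := congrArg (TensorProduct.rid R A ∘ TensorProduct.map LinearMap.id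
        (Coalgebra.counit (R := R) (A := B))) (hx x 1)
      simpa [expAux_one U hU, LinearMap.convOne_def, Algebra.algebraMap_eq_smul_one] using this
    · apply WithConv.ofConv_injective
      ext x
      have := congrArg (TensorProduct.lid R B ∘ TensorProduct.map
        (Coalgebra.counit (R := R) (A := A)) LinearMap.id) (hx 1 x)
      simpa [expAux_one T hT, LinearMap.convOne_def, Algebra.algebraMap_eq_smul_one] using this
  · rintro ⟨h1, h2⟩
    rw [expAux_tensor, h1, h2]
    exact h0.symm

/-- The exponent of a tensor product of Hopf algebras is the least common multiple of the
exponents (here `0` encodes `∞`, and `Nat.lcm x 0 = 0`, so in particular this says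
`exp(H₁ ⊗ H₂)` is finite iff both `exp(H₁)` and `exp(H₂)` are).  The inverse of the antipode
`S₁ ⊗ S₂` of `H₁ ⊗ H₂` is `Sinv₁ ⊗ Sinv₂`. -/
theorem hopfExponent_tensorProduct {k H₁ H₂ : Type u} [Field k]
    [Ring H₁] [HopfAlgebra k H₁] [Ring H₂] [HopfAlgebra k H₂]
    (Sinv₁ : H₁ →ₗ[k] H₁)
    (hS1₁ : Sinv₁ ∘ₗ HopfAlgebra.antipode (R := k) (A := H₁) = LinearMap.id)
    (hS2₁ : HopfAlgebra.antipode (R := k) (A := H₁) ∘ₗ Sinv₁ = LinearMap.id)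
    (Sinv₂ : H₂ →ₗ[k] H₂)
    (hS1₂ : Sinv₂ ∘ₗ HopfAlgebra.antipode (R := k) (A := H₂) = LinearMap.id)
    (hS2₂ : HopfAlgebra.antipode (R := k) (A := H₂) ∘ₗ Sinv₂ = LinearMap.id) :
    hopfExponent k (H₁ ⊗[k] H₂) (TensorProduct.map Sinv₁ Sinv₂)
      = Nat.lcm (hopfExponent k H₁ Sinv₁) (hopfExponent k H₂ Sinv₂) := by
  obtain ⟨ha₁, hb₁, hc₁⟩ := sq_props Sinv₁ hS1₁ hS2₁
  obtain ⟨ha₂, hb₂, hc₂⟩ := sq_props Sinv₂ hS1₂ hS2₂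
  have key : ∀ n, expAux (TensorProduct.map Sinv₁ Sinv₂ ∘ₗ TensorProduct.map Sinv₁ Sinv₂) n = 1 ↔
      Nat.lcm (hopfExponent k H₁ Sinv₁) (hopfExponent k H₂ Sinv₂) ∣ n := by
    intro n
    rw [← TensorProduct.map_comp, expAux_tensor_iff _ _ ha₁ ha₂, hopfExponent_dvd _ hS1₁ hS2₁,
      hopfExponent_dvd _ hS1₂ hS2₂, Nat.lcm_dvd_iff]
  rw [hopfExponent_eq]
  simp only [key]
  generalize Nat.lcm (hopfExponent k H₁ Sinv₁) (hopfExponent k H₂ Sinv₂) = d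
  apply Nat.dvd_antisymm
  · exact (mem_iff_sInf_dvd (fun n => d ∣ n) (dvd_zero d)
      (fun n m h => (Nat.dvd_add_right h)) d).1 dvd_rfl
  · exact (mem_iff_sInf_dvd (fun n => d ∣ n) (dvd_zero d)
      (fun n m h => (Nat.dvd_add_right h)) _).2 dvd_rfl

end
end

section
/- Let H be a Hopf algebra over a field k with bijective antipode. If exp(H) = 2, then H is commutative (as an algebra) and cocommutative (τ ∘ Δ = Δ, where τ is the flip of tensor factors). -/
open TensorProduct

noncomputable section

variable (k H : Type*) [CommSemiring k] [Semiring H] [Bialgebra k H]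

open WithConv HopfAlgebra in
theorem comul_antipode_aux {k H : Type*} [Field k] [Ring H] [HopfAlgebra k H] :
    (Coalgebra.comul ∘ₗ antipode k : H →ₗ[k] H ⊗[k] H) =
      TensorProduct.map (antipode k) (antipode k) ∘ₗ
        (TensorProduct.comm k H H).toLinearMap ∘ₗ Coalgebra.comul := by
  let i1 : H →ₐ[k] H ⊗[k] H := Algebra.TensorProduct.includeLeft
  let i2 : H →ₐ[k] H ⊗[k] H := Algebra.TensorProduct.includeRight
  have hinv : ∀ i : H →ₐ[k] H ⊗[k] H,
      toConv (i.toLinearMap ∘ₗ antipode k) * toConv i.toLinearMap = 1 := by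
    intro i
    have h := LinearMap.algHom_comp_convMul_distrib i
      (toConv (antipode k (A := H))) (toConv (LinearMap.id (R := k) (M := H)))
    rw [LinearMap.antipode_mul_id] at h
    have h2 := congrArg toConv h
    simp only [ofConv_toConv, toConv_ofConv, LinearMap.comp_id] at h2
    rw [← h2]
    ext x
    simp [LinearMap.convOne_def]
  have hD : toConv (Coalgebra.comul : H →ₗ[k] H ⊗[k] H) =
      toConv i1.toLinearMap * toConv i2.toLinearMap := by
    ext x
    rw [(Coalgebra.Repr.arbitrary k x).convMul_apply]
    conv_lhs => rw [← (Coalgebra.Repr.arbitrary k x).eq]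
    simp [i1, i2, ← (Coalgebra.Repr.arbitrary k x).eq]
  have hG : toConv (TensorProduct.map (antipode k) (antipode k) ∘ₗ
        (TensorProduct.comm k H H).toLinearMap ∘ₗ Coalgebra.comul) =
      toConv (i2.toLinearMap ∘ₗ antipode k) * toConv (i1.toLinearMap ∘ₗ antipode k) := by
    ext x
    rw [(Coalgebra.Repr.arbitrary k x).convMul_apply]
    simp [i1, i2, ← (Coalgebra.Repr.arbitrary k x).eq]
  apply toConv_injective
  symm
  refine left_inv_eq_right_inv (a := toConv (Coalgebra.comul : H →ₗ[k] H ⊗[k] H)) ?_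
    LinearMap.comul_right_inv
  rw [hG, hD, mul_assoc, ← mul_assoc (toConv (i1.toLinearMap ∘ₗ antipode k)), hinv, one_mul, hinv]

/-- If `exp(H) = 2` then `H` is commutative and cocommutative. -/
theorem comm_cocomm_of_exponent_two {k H : Type*} [Field k] [Ring H] [HopfAlgebra k H]
    (Sinv : H →ₗ[k] H)
    (hS1 : Sinv ∘ₗ HopfAlgebra.antipode (R := k) (A := H) = LinearMap.id)
    (hS2 : HopfAlgebra.antipode (R := k) (A := H) ∘ₗ Sinv = LinearMap.id)
    (hexp : hopfExponent k H Sinv = 2) :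
    (∀ x y : H, x * y = y * x) ∧
      (∀ x : H, TensorProduct.comm k H H (Coalgebra.comul (R := k) x)
        = Coalgebra.comul (R := k) x) := by
  have hmem : 2 ∈ {n : ℕ | 0 < n ∧ expMap k H Sinv n = counitUnit k H} := by
    rw [← hexp]
    apply Nat.sInf_mem
    apply Nat.nonempty_of_pos_sInf
    change 0 < hopfExponent k H Sinv
    omega
  have h2 : conv k H LinearMap.id (Sinv ∘ₗ Sinv) = counitUnit k H := by
    have := hmem.2
    simpa only [expMap, zero_add, pow_one] using this
  have hS : HopfAlgebra.antipode k (A := H) = Sinv ∘ₗ Sinv := by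
    apply WithConv.toConv_injective
    refine left_inv_eq_right_inv (a := WithConv.toConv (LinearMap.id (R := k) (M := H)))
      LinearMap.antipode_mul_id ?_
    exact congrArg WithConv.toConv h2
  have h22 : ∀ x, HopfAlgebra.antipode k (Sinv x) = x := fun x => LinearMap.congr_fun hS2 x
  have h3 : ∀ x : H, HopfAlgebra.antipode k (HopfAlgebra.antipode k
      (HopfAlgebra.antipode k x)) = x := by
    intro x
    have h := LinearMap.congr_fun hS x
    rw [h, LinearMap.comp_apply, h22, h22]
  refine ⟨fun x y => ?_, fun x => ?_⟩
  · rw [← h3 (x * y)]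
    simp only [HopfAlgebra.antipode_mul_antidistrib (R := k)]
    rw [h3, h3]
  · have hc : ∀ x : H, Coalgebra.comul (R := k) (HopfAlgebra.antipode k x) =
        TensorProduct.map (HopfAlgebra.antipode k) (HopfAlgebra.antipode k)
          (TensorProduct.comm k H H (Coalgebra.comul (R := k) x)) :=
      fun x => LinearMap.congr_fun comul_antipode_aux x
    conv_rhs => rw [← h3 x]
    rw [hc, hc, hc]
    induction Coalgebra.comul (R := k) x using TensorProduct.induction_on with
    | zero => simp
    | tmul a b => simp [h3]
    | add a b ha hb => simp only [map_add]; exact congrArg₂ (· + ·) ha hb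

end
end

section
/- Let H₁ and H₂ be Hopf algebras over a field k with bijective antipodes, and let f : H₁ → H₂ be an injective bialgebra homomorphism (an algebra homomorphism that also satisfies Δ ∘ f = (f ⊗ f) ∘ Δ and ε ∘ f = ε; such a map automatically intertwines the antipodes). If exp(H₂) = n is finite, then exp(H₁) is finite and divides n. -/
open TensorProduct

noncomputable section

variable (k H : Type*) [CommSemiring k] [Semiring H] [Bialgebra k H]

open WithConv in
theorem aux_conv_eq {K A : Type*} [Field K] [Ring A] [HopfAlgebra K A] (f g : A →ₗ[K] A) :
    conv K A f g = (toConv f * toConv g).ofConv := rfl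

open WithConv in
theorem aux_conv_assoc {K A : Type*} [Field K] [Ring A] [HopfAlgebra K A] (f g h : A →ₗ[K] A) :
    conv K A (conv K A f g) h = conv K A f (conv K A g h) := by
  have := mul_assoc (toConv f) (toConv g) (toConv h)
  exact congrArg WithConv.ofConv this

open WithConv in
theorem aux_one_conv {K A : Type*} [Field K] [Ring A] [HopfAlgebra K A] (f : A →ₗ[K] A) :
    conv K A (counitUnit K A) f = f :=
  congrArg WithConv.ofConv (one_mul (toConv f))

theorem aux_comp_conv {K A : Type*} [Field K] [Ring A] [HopfAlgebra K A]
    (φ : A →ₐ[K] A) (f g : A →ₗ[K] A) :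
    φ.toLinearMap ∘ₗ conv K A f g = conv K A (φ.toLinearMap ∘ₗ f) (φ.toLinearMap ∘ₗ g) :=
  LinearMap.algHom_comp_convMul_distrib φ (WithConv.toConv f) (WithConv.toConv g)

theorem aux_pow_algHom {K A : Type*} [Field K] [Ring A] [HopfAlgebra K A]
    (T : A →ₗ[K] A) (φ : A →ₐ[K] A) (h : φ.toLinearMap = T) (n : ℕ) :
    (φ ^ n).toLinearMap = T ^ n := by
  induction n with
  | zero => rfl
  | succ n ih => rw [pow_succ, pow_succ, ← ih, ← h]; rfl

theorem aux_add {K A : Type*} [Field K] [Ring A] [HopfAlgebra K A]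
    (S : A →ₗ[K] A) (φ : A →ₐ[K] A) (h : φ.toLinearMap = S ∘ₗ S) (a b : ℕ) :
    expMap K A S (a + 1 + (b + 1)) =
      conv K A (expMap K A S (a + 1)) (((S ∘ₗ S) ^ (a + 1) : A →ₗ[K] A) ∘ₗ expMap K A S (b + 1)) := by
  induction b with
  | zero => rfl
  | succ b ih =>
    have e : expMap K A S (a + 1 + (b + 1 + 1)) =
        conv K A (expMap K A S (a + 1 + (b + 1))) ((S ∘ₗ S) ^ (a + 1 + (b + 1))) := by
      have h1 : a + 1 + (b + 1 + 1) = (a + b + 1) + 2 := by ring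
      have h2 : a + 1 + (b + 1) = (a + b + 1) + 1 := by ring
      rw [h1, h2]; rfl
    rw [e, ih, aux_conv_assoc]
    congr 1
    have e2 : expMap K A S (b + 1 + 1) =
      conv K A (expMap K A S (b + 1)) ((S ∘ₗ S) ^ (b + 1)) := rfl
    rw [e2, ← aux_pow_algHom _ φ h (a + 1), aux_comp_conv, aux_pow_algHom _ φ h (a + 1), pow_add _ (a + 1) (b + 1)]
    rfl

theorem aux_algHom {K A : Type*} [Field K] [Ring A] [HopfAlgebra K A] (S : A →ₗ[K] A)
    (h1 : S ∘ₗ HopfAlgebra.antipode (R := K) (A := A) = LinearMap.id)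
    (h2 : HopfAlgebra.antipode (R := K) (A := A) ∘ₗ S = LinearMap.id) :
    ∃ φ : A →ₐ[K] A, φ.toLinearMap = S ∘ₗ S := by
  have h1' : ∀ x, S (HopfAlgebra.antipode K x) = x := fun x => LinearMap.congr_fun h1 x
  have h2' : ∀ x, HopfAlgebra.antipode K (S x) = x := fun x => LinearMap.congr_fun h2 x
  have hone : S 1 = 1 := by
    have := h1' 1
    rwa [HopfAlgebra.antipode_one] at this
  have hmul : ∀ x y, S (x * y) = S y * S x := by
    intro x y
    rw [← h1' (S y * S x), HopfAlgebra.antipode_mul_antidistrib, h2', h2']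
  exact ⟨AlgHom.ofLinearMap (S ∘ₗ S) (by simp [hone]) (by intro x y; simp [hmul]), rfl⟩

theorem aux_sub {K A : Type*} [Field K] [Ring A] [HopfAlgebra K A] (S : A →ₗ[K] A)
    (h1 : S ∘ₗ HopfAlgebra.antipode (R := K) (A := A) = LinearMap.id)
    (h2 : HopfAlgebra.antipode (R := K) (A := A) ∘ₗ S = LinearMap.id) (a b : ℕ)
    (ha : 0 < a) (hb : 0 < b) (hEa : expMap K A S a = counitUnit K A)
    (hE : expMap K A S (a + b) = counitUnit K A) : expMap K A S b = counitUnit K A := by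
  obtain ⟨φ, hφ⟩ := aux_algHom S h1 h2
  obtain ⟨a, rfl⟩ := Nat.exists_eq_add_of_lt ha
  obtain ⟨b, rfl⟩ := Nat.exists_eq_add_of_lt hb
  simp only [zero_add] at *
  rw [aux_add S φ hφ, hEa, aux_one_conv] at hE
  have hinj : Function.Injective ((S ∘ₗ S) ^ (a + 1) : A →ₗ[K] A) := by
    have hS : Function.Injective S :=
      Function.LeftInverse.injective (g := HopfAlgebra.antipode K) fun x => LinearMap.congr_fun h2 x
    rw [Module.End.coe_pow]
    exact Function.Injective.iterate (hS.comp hS) _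
  apply LinearMap.ext
  intro x
  apply hinj
  have := LinearMap.congr_fun hE x
  rw [LinearMap.comp_apply] at this
  rw [this, ← aux_pow_algHom _ φ hφ]
  simp [counitUnit]

theorem aux_dvd {K A : Type*} [Field K] [Ring A] [HopfAlgebra K A] (S : A →ₗ[K] A)
    (h1 : S ∘ₗ HopfAlgebra.antipode (R := K) (A := A) = LinearMap.id)
    (h2 : HopfAlgebra.antipode (R := K) (A := A) ∘ₗ S = LinearMap.id) (d : ℕ) (hd : 0 < d)
    (hEd : expMap K A S d = counitUnit K A)
    (hmin : ∀ m, 0 < m → expMap K A S m = counitUnit K A → d ≤ m) (n : ℕ) :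
    0 < n → expMap K A S n = counitUnit K A → d ∣ n := by
  induction n using Nat.strong_induction_on with
  | _ n ih =>
    intro hn hE
    have hle := hmin n hn hE
    obtain ⟨c, rfl⟩ := Nat.exists_eq_add_of_le hle
    rcases Nat.eq_zero_or_pos c with rfl | hc
    · simp
    · exact dvd_add dvd_rfl (ih c (by omega) hc (aux_sub S h1 h2 d c hd hc hEd hE))

open WithConv in
theorem aux_antipode {k H₁ H₂ : Type*} [Field k]
    [Ring H₁] [HopfAlgebra k H₁] [Ring H₂] [HopfAlgebra k H₂]
    (f : H₁ →ₐ[k] H₂) 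
    (hΔ : Coalgebra.comul (R := k) ∘ₗ f.toLinearMap
      = TensorProduct.map f.toLinearMap f.toLinearMap ∘ₗ Coalgebra.comul)
    (hε : Coalgebra.counit (R := k) ∘ₗ f.toLinearMap = Coalgebra.counit (R := k)) :
    f.toLinearMap ∘ₗ HopfAlgebra.antipode k (A := H₁)
      = HopfAlgebra.antipode k (A := H₂) ∘ₗ f.toLinearMap := by
  apply WithConv.toConv_injective
  symm
  apply left_inv_eq_right_inv (a := toConv f.toLinearMap)
  · let g : H₁ →ₗc[k] H₂ := { f.toLinearMap with counit_comp := hε, map_comp_comul := hΔ.symm }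
    have := LinearMap.convMul_comp_coalgHom_distrib (toConv (HopfAlgebra.antipode k (A := H₂)))
      (toConv LinearMap.id) g
    rw [LinearMap.antipode_mul_id] at this
    have h := congrArg toConv this
    refine Eq.trans (Eq.symm h) ?_
    ext x
    have := LinearMap.congr_fun hε x
    exact congrArg (algebraMap k H₂) this
  · have := LinearMap.algHom_comp_convMul_distrib f (toConv LinearMap.id)
      (toConv (HopfAlgebra.antipode k (A := H₁)))
    rw [LinearMap.id_mul_antipode] at this
    have h := congrArg toConv this
    refine Eq.trans (Eq.symm h) ?_
    ext x
    exact f.commutes _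

theorem aux_expMap {k H₁ H₂ : Type*} [Field k]
    [Ring H₁] [HopfAlgebra k H₁] [Ring H₂] [HopfAlgebra k H₂]
    (S₁ : H₁ →ₗ[k] H₁) (S₂ : H₂ →ₗ[k] H₂) (f : H₁ →ₐ[k] H₂)
    (hΔ : Coalgebra.comul (R := k) ∘ₗ f.toLinearMap
      = TensorProduct.map f.toLinearMap f.toLinearMap ∘ₗ Coalgebra.comul)
    (hS : ∀ x, f (S₁ x) = S₂ (f x)) (n : ℕ) :
    f.toLinearMap ∘ₗ expMap k H₁ S₁ (n + 1) = expMap k H₂ S₂ (n + 1) ∘ₗ f.toLinearMap := by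
  have hpow : ∀ m : ℕ, f.toLinearMap ∘ₗ ((S₁ ∘ₗ S₁) ^ m : H₁ →ₗ[k] H₁)
      = ((S₂ ∘ₗ S₂) ^ m : H₂ →ₗ[k] H₂) ∘ₗ f.toLinearMap := by
    intro m
    induction m with
    | zero => rfl
    | succ m ih =>
      ext x
      have := LinearMap.congr_fun ih (S₁ (S₁ x))
      simp only [LinearMap.comp_apply, AlgHom.toLinearMap_apply, hS] at this
      simp only [pow_succ, Module.End.mul_apply, LinearMap.comp_apply, AlgHom.toLinearMap_apply]
      exact this
  induction n with
  | zero => rfl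
  | succ n ih =>
    change f.toLinearMap ∘ₗ conv k H₁ (expMap k H₁ S₁ (n + 1)) ((S₁ ∘ₗ S₁) ^ (n + 1)) =
      conv k H₂ (expMap k H₂ S₂ (n + 1)) ((S₂ ∘ₗ S₂) ^ (n + 1)) ∘ₗ f.toLinearMap
    have e := LinearMap.algHom_comp_convMul_distrib f (WithConv.toConv (expMap k H₁ S₁ (n + 1)))
      (WithConv.toConv ((S₁ ∘ₗ S₁) ^ (n + 1)))
    refine Eq.trans e ?_
    simp only [LinearMap.convMul_def, conv, WithConv.ofConv_toConv, LinearMap.comp_assoc]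
    rw [hΔ, ih, hpow, TensorProduct.map_comp]
    rfl

/-- The exponent of a Hopf subalgebra divides the exponent: if `f : H₁ → H₂` is an injective
bialgebra homomorphism and `exp(H₂) = n < ∞`, then `exp(H₁)` is finite and divides `n`. -/
theorem hopfExponent_dvd_of_injective {k H₁ H₂ : Type*} [Field k]
    [Ring H₁] [HopfAlgebra k H₁] [Ring H₂] [HopfAlgebra k H₂]
    (Sinv₁ : H₁ →ₗ[k] H₁)
    (hS1₁ : Sinv₁ ∘ₗ HopfAlgebra.antipode (R := k) (A := H₁) = LinearMap.id)
    (hS2₁ : HopfAlgebra.antipode (R := k) (A := H₁) ∘ₗ Sinv₁ = LinearMap.id)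
    (Sinv₂ : H₂ →ₗ[k] H₂)
    (hS1₂ : Sinv₂ ∘ₗ HopfAlgebra.antipode (R := k) (A := H₂) = LinearMap.id)
    (hS2₂ : HopfAlgebra.antipode (R := k) (A := H₂) ∘ₗ Sinv₂ = LinearMap.id)
    (f : H₁ →ₐ[k] H₂) (hf : Function.Injective f)
    (hΔ : Coalgebra.comul (R := k) ∘ₗ f.toLinearMap
      = TensorProduct.map f.toLinearMap f.toLinearMap ∘ₗ Coalgebra.comul)
    (hε : Coalgebra.counit (R := k) ∘ₗ f.toLinearMap = Coalgebra.counit (R := k))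
    (n : ℕ) (hn : 0 < n) (hexp : hopfExponent k H₂ Sinv₂ = n) :
    hopfExponent k H₁ Sinv₁ ≠ 0 ∧ hopfExponent k H₁ Sinv₁ ∣ n := by
  have hS : ∀ x, f (Sinv₁ x) = Sinv₂ (f x) := by
    intro x
    have h := LinearMap.congr_fun (aux_antipode f hΔ hε) (Sinv₁ x)
    have h2 : HopfAlgebra.antipode k (Sinv₁ x) = x := LinearMap.congr_fun hS2₁ x
    simp only [LinearMap.comp_apply, AlgHom.toLinearMap_apply, h2] at h
    rw [h]
    exact (LinearMap.congr_fun hS1₂ (f (Sinv₁ x))).symm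
  have hne : {n : ℕ | 0 < n ∧ expMap k H₂ Sinv₂ n = counitUnit k H₂}.Nonempty := by
    apply Nat.nonempty_of_pos_sInf
    change 0 < hopfExponent k H₂ Sinv₂
    omega
  have hmem := Nat.sInf_mem hne
  change _ ∧ expMap k H₂ Sinv₂ (hopfExponent k H₂ Sinv₂) = _ at hmem
  rw [hexp] at hmem
  have hE2 := hmem.2
  have hE1 : expMap k H₁ Sinv₁ n = counitUnit k H₁ := by
    obtain ⟨m, rfl⟩ := Nat.exists_eq_add_of_lt hn
    rw [zero_add] at *
    have h := aux_expMap Sinv₁ Sinv₂ f hΔ hS m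
    rw [hE2] at h
    ext x
    apply hf
    have hx := LinearMap.congr_fun h x
    have hc : Coalgebra.counit (R := k) (f x) = Coalgebra.counit (R := k) x :=
      LinearMap.congr_fun hε x
    simp only [LinearMap.comp_apply, AlgHom.toLinearMap_apply, counitUnit, hc] at hx
    rw [hx]
    exact (f.commutes _).symm
  have hne1 : {n : ℕ | 0 < n ∧ expMap k H₁ Sinv₁ n = counitUnit k H₁}.Nonempty := ⟨n, hn, hE1⟩
  have hm1 := Nat.sInf_mem hne1
  exact ⟨hm1.1.ne', aux_dvd Sinv₁ hS1₁ hS2₁ _ hm1.1 hm1.2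
    (fun m hm hE => Nat.sInf_le ⟨hm, hE⟩) n hn hE1⟩

end
end

section
/- Let H₁ and H₂ be Hopf algebras over a field k with bijective antipodes, and let f : H₁ → H₂ be a surjective bialgebra homomorphism (an algebra homomorphism that also satisfies Δ ∘ f = (f ⊗ f) ∘ Δ and ε ∘ f = ε; such a map automatically intertwines the antipodes). If exp(H₁) = n is finite, then exp(H₂) is finite and divides n. -/
open TensorProduct

noncomputable section

variable (k H : Type*) [CommSemiring k] [Semiring H] [Bialgebra k H]

section helpers

open WithConv Coalgebra

variable {R A : Type*} [Field R] [Ring A] [HopfAlgebra R A]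

theorem toConv_conv (f g : A →ₗ[R] A) : toConv (conv R A f g) = toConv f * toConv g := rfl

theorem toConv_counitUnit : toConv (counitUnit R A) = 1 := rfl

theorem sinv_mul (Si : A →ₗ[R] A)
    (h1 : Si ∘ₗ HopfAlgebra.antipode (R := R) (A := A) = LinearMap.id)
    (h2 : HopfAlgebra.antipode (R := R) (A := A) ∘ₗ Si = LinearMap.id) (a b : A) :
    Si (a * b) = Si b * Si a := by
  have e1 : ∀ x, Si (HopfAlgebra.antipode R x) = x := fun x => LinearMap.congr_fun h1 x
  have e2 : ∀ x, HopfAlgebra.antipode R (Si x) = x := fun x => LinearMap.congr_fun h2 x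
  have : a * b = HopfAlgebra.antipode R (Si b * Si a) := by
    rw [HopfAlgebra.antipode_mul_antidistrib, e2, e2]
  rw [this, e1]

theorem sinv_one (Si : A →ₗ[R] A)
    (h1 : Si ∘ₗ HopfAlgebra.antipode (R := R) (A := A) = LinearMap.id) : Si 1 = 1 := by
  have e1 : Si (HopfAlgebra.antipode R (1 : A)) = 1 := LinearMap.congr_fun h1 1
  rwa [HopfAlgebra.antipode_one] at e1

/-- The square of the inverse antipode as an algebra map. -/
def sqHom (Si : A →ₗ[R] A)
    (h1 : Si ∘ₗ HopfAlgebra.antipode (R := R) (A := A) = LinearMap.id)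
    (h2 : HopfAlgebra.antipode (R := R) (A := A) ∘ₗ Si = LinearMap.id) : A →ₐ[R] A :=
  AlgHom.ofLinearMap (Si ∘ₗ Si) (by simp [sinv_one Si h1])
    (fun x y => by simp [sinv_mul Si h1 h2])

theorem sqHom_pow (Si : A →ₗ[R] A)
    (h1 : Si ∘ₗ HopfAlgebra.antipode (R := R) (A := A) = LinearMap.id)
    (h2 : HopfAlgebra.antipode (R := R) (A := A) ∘ₗ Si = LinearMap.id) (n : ℕ) :
    (sqHom Si h1 h2 ^ n).toLinearMap = (Si ∘ₗ Si) ^ n := by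
  induction n with
  | zero => rfl
  | succ n ih => rw [pow_succ, pow_succ, ← ih]; rfl

theorem expMap_add_s7 (Si : A →ₗ[R] A)
    (h1 : Si ∘ₗ HopfAlgebra.antipode (R := R) (A := A) = LinearMap.id)
    (h2 : HopfAlgebra.antipode (R := R) (A := A) ∘ₗ Si = LinearMap.id) (a b : ℕ) :
    toConv (expMap R A Si (a + 1 + (b + 1))) = toConv (expMap R A Si (a + 1)) *
      toConv ((sqHom Si h1 h2 ^ (a + 1)).toLinearMap ∘ₗ expMap R A Si (b + 1)) := by
  induction b with
  | zero =>
    rw [sqHom_pow]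
    rfl
  | succ b ih =>
    have e1 : expMap R A Si (a + 1 + (b + 1 + 1)) =
      conv R A (expMap R A Si (a + 1 + (b + 1))) ((Si ∘ₗ Si) ^ (a + 1 + (b + 1))) := rfl
    have e2 : expMap R A Si (b + 1 + 1) =
      ofConv (toConv (expMap R A Si (b + 1)) * toConv ((Si ∘ₗ Si) ^ (b + 1))) := rfl
    rw [e1, toConv_conv, ih, mul_assoc, e2, LinearMap.algHom_comp_convMul_distrib]
    congr 2
    rw [ofConv_toConv, sqHom_pow, pow_add _ (a + 1) (b + 1)]
    rfl

theorem sqHom_pow_injective (Si : A →ₗ[R] A)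
    (h1 : Si ∘ₗ HopfAlgebra.antipode (R := R) (A := A) = LinearMap.id)
    (h2 : HopfAlgebra.antipode (R := R) (A := A) ∘ₗ Si = LinearMap.id) (n : ℕ) :
    Function.Injective (sqHom Si h1 h2 ^ n) := by
  have hi : Function.Injective Si := by
    intro x y hxy
    have e2 : ∀ x, HopfAlgebra.antipode R (Si x) = x := fun x => LinearMap.congr_fun h2 x
    rw [← e2 x, hxy, e2]
  induction n with
  | zero => exact fun x y h => h
  | succ n ih =>
    rw [pow_succ]
    exact ih.comp (hi.comp hi)

theorem expMap_sub (Si : A →ₗ[R] A)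
    (h1 : Si ∘ₗ HopfAlgebra.antipode (R := R) (A := A) = LinearMap.id)
    (h2 : HopfAlgebra.antipode (R := R) (A := A) ∘ₗ Si = LinearMap.id) (a b : ℕ)
    (ha : 0 < a) (hb : 0 < b) (hea : expMap R A Si a = counitUnit R A)
    (heab : expMap R A Si (a + b) = counitUnit R A) : expMap R A Si b = counitUnit R A := by
  obtain ⟨a, rfl⟩ := Nat.exists_eq_succ_of_ne_zero ha.ne'
  obtain ⟨b, rfl⟩ := Nat.exists_eq_succ_of_ne_zero hb.ne'
  have h := expMap_add_s7 Si h1 h2 a b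
  simp only [Nat.succ_eq_add_one] at *
  rw [heab, hea, toConv_counitUnit, one_mul] at h
  ext x
  apply sqHom_pow_injective Si h1 h2 (a + 1)
  have hx : (sqHom Si h1 h2 ^ (a + 1)) (expMap R A Si (b + 1) x) =
      algebraMap R A (counit (R := R) x) := (LinearMap.congr_fun (congrArg ofConv h) x).symm
  rw [hx]
  exact (AlgHom.commutes _ _).symm

theorem exponent_dvd (Si : A →ₗ[R] A)
    (h1 : Si ∘ₗ HopfAlgebra.antipode (R := R) (A := A) = LinearMap.id)
    (h2 : HopfAlgebra.antipode (R := R) (A := A) ∘ₗ Si = LinearMap.id) (n : ℕ)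
    (hn : 0 < n) (he : expMap R A Si n = counitUnit R A) :
    hopfExponent R A Si ≠ 0 ∧ hopfExponent R A Si ∣ n := by
  have hm : hopfExponent R A Si ∈ {n : ℕ | 0 < n ∧ expMap R A Si n = counitUnit R A} :=
    Nat.sInf_mem ⟨n, hn, he⟩
  have hle : ∀ j, 0 < j → expMap R A Si j = counitUnit R A → hopfExponent R A Si ≤ j :=
    fun j hj hj' => Nat.sInf_le ⟨hj, hj'⟩
  generalize hopfExponent R A Si = m at hm hle
  obtain ⟨m0, hme⟩ := hm
  refine ⟨m0.ne', ?_⟩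
  induction n using Nat.strong_induction_on with
  | _ n ih =>
    obtain ⟨c, rfl⟩ := Nat.exists_eq_add_of_le (hle n hn he)
    rcases Nat.eq_zero_or_pos c with rfl | hc
    · simp
    · exact (Nat.dvd_add_right (dvd_refl m)).2
        (ih c (by omega) hc (expMap_sub Si h1 h2 m c m0 hc hme he))

variable {B : Type*} [Ring B] [HopfAlgebra R B]

theorem comp_conv_eq (f : A →ₐ[R] B)
    (hΔ : Coalgebra.comul (R := R) ∘ₗ f.toLinearMap
      = TensorProduct.map f.toLinearMap f.toLinearMap ∘ₗ Coalgebra.comul)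
    (u v : A →ₗ[R] A) (u' v' : B →ₗ[R] B)
    (hu : f.toLinearMap ∘ₗ u = u' ∘ₗ f.toLinearMap)
    (hv : f.toLinearMap ∘ₗ v = v' ∘ₗ f.toLinearMap) :
    f.toLinearMap ∘ₗ conv R A u v = conv R B u' v' ∘ₗ f.toLinearMap := by
  have e : f.toLinearMap ∘ₗ conv R A u v = _ :=
    LinearMap.algHom_comp_convMul_distrib f (toConv u) (toConv v)
  rw [e, ofConv_toConv, ofConv_toConv, hu, hv]
  rw [LinearMap.convMul_def]
  simp only [conv, ofConv_toConv, LinearMap.comp_assoc, hΔ, TensorProduct.map_comp]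

theorem comp_antipode (f : A →ₐ[R] B)
    (hΔ : Coalgebra.comul (R := R) ∘ₗ f.toLinearMap
      = TensorProduct.map f.toLinearMap f.toLinearMap ∘ₗ Coalgebra.comul)
    (hε : Coalgebra.counit (R := R) ∘ₗ f.toLinearMap = Coalgebra.counit (R := R)) :
    f.toLinearMap ∘ₗ HopfAlgebra.antipode (R := R) (A := A) =
      HopfAlgebra.antipode (R := R) (A := B) ∘ₗ f.toLinearMap := by
  have l : toConv (f.toLinearMap ∘ₗ HopfAlgebra.antipode (R := R) (A := A)) *
      toConv f.toLinearMap = 1 := by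
    have e := LinearMap.algHom_comp_convMul_distrib f
      (toConv (HopfAlgebra.antipode (R := R) (A := A))) (toConv LinearMap.id)
    rw [LinearMap.antipode_mul_id] at e
    apply ofConv_injective
    refine e.symm.trans ?_
    ext x
    exact f.commutes _
  have r : toConv f.toLinearMap *
      toConv (HopfAlgebra.antipode (R := R) (A := B) ∘ₗ f.toLinearMap) = 1 := by
    have e := LinearMap.id_mul_antipode (R := R) (C := B)
    have e' := congrArg (fun t => ofConv t ∘ₗ f.toLinearMap) e
    apply ofConv_injective
    refine Eq.trans ?_ (e'.trans ?_)
    · simp only [LinearMap.convMul_def, ofConv_toConv, LinearMap.comp_assoc, hΔ]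
      rw [← LinearMap.comp_assoc Coalgebra.comul (TensorProduct.map f.toLinearMap f.toLinearMap),
        ← TensorProduct.map_comp]
      rfl
    · rw [LinearMap.convOne_def, LinearMap.convOne_def, ofConv_toConv, ofConv_toConv,
        LinearMap.comp_assoc, hε]
  exact toConv_injective (left_inv_eq_right_inv l r)

theorem comp_sinv (f : A →ₐ[R] B)
    (hΔ : Coalgebra.comul (R := R) ∘ₗ f.toLinearMap
      = TensorProduct.map f.toLinearMap f.toLinearMap ∘ₗ Coalgebra.comul)
    (hε : Coalgebra.counit (R := R) ∘ₗ f.toLinearMap = Coalgebra.counit (R := R))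
    (Si : A →ₗ[R] A) (Sj : B →ₗ[R] B)
    (h2 : HopfAlgebra.antipode (R := R) (A := A) ∘ₗ Si = LinearMap.id)
    (h1 : Sj ∘ₗ HopfAlgebra.antipode (R := R) (A := B) = LinearMap.id) :
    f.toLinearMap ∘ₗ Si = Sj ∘ₗ f.toLinearMap := by
  calc f.toLinearMap ∘ₗ Si
      = (Sj ∘ₗ HopfAlgebra.antipode (R := R) (A := B)) ∘ₗ f.toLinearMap ∘ₗ Si := by
        rw [h1, LinearMap.id_comp]
    _ = Sj ∘ₗ (HopfAlgebra.antipode (R := R) (A := B) ∘ₗ f.toLinearMap) ∘ₗ Si := rfl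
    _ = Sj ∘ₗ f.toLinearMap ∘ₗ (HopfAlgebra.antipode (R := R) (A := A) ∘ₗ Si) := by
        rw [← comp_antipode f hΔ hε]; rfl
    _ = _ := by rw [h2, LinearMap.comp_id]

theorem comp_expMap (f : A →ₐ[R] B)
    (hΔ : Coalgebra.comul (R := R) ∘ₗ f.toLinearMap
      = TensorProduct.map f.toLinearMap f.toLinearMap ∘ₗ Coalgebra.comul)
    (Si : A →ₗ[R] A) (Sj : B →ₗ[R] B)
    (h : f.toLinearMap ∘ₗ Si = Sj ∘ₗ f.toLinearMap) (n : ℕ) :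
    f.toLinearMap ∘ₗ expMap R A Si (n + 1) = expMap R B Sj (n + 1) ∘ₗ f.toLinearMap := by
  have hx : ∀ x, f (Si x) = Sj (f x) := fun x => LinearMap.congr_fun h x
  have hp : ∀ j : ℕ, f.toLinearMap ∘ₗ ((Si ∘ₗ Si) ^ j) = ((Sj ∘ₗ Sj) ^ j) ∘ₗ f.toLinearMap := by
    intro j
    induction j with
    | zero => rfl
    | succ j ih =>
      ext x
      have := LinearMap.congr_fun ih (Si (Si x))
      simp only [LinearMap.comp_apply, AlgHom.toLinearMap_apply, hx] at this
      simpa [pow_succ] using this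
  induction n with
  | zero => rfl
  | succ n ih => exact comp_conv_eq f hΔ _ _ _ _ ih (hp (n + 1))

end helpers

/-- The exponent of a quotient Hopf algebra divides the exponent: if `f : H₁ → H₂` is a
surjective bialgebra homomorphism and `exp(H₁) = n < ∞`, then `exp(H₂)` is finite and
divides `n`. -/
theorem hopfExponent_dvd_of_surjective {k H₁ H₂ : Type*} [Field k]
    [Ring H₁] [HopfAlgebra k H₁] [Ring H₂] [HopfAlgebra k H₂]
    (Sinv₁ : H₁ →ₗ[k] H₁)
    (hS1₁ : Sinv₁ ∘ₗ HopfAlgebra.antipode (R := k) (A := H₁) = LinearMap.id)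
    (hS2₁ : HopfAlgebra.antipode (R := k) (A := H₁) ∘ₗ Sinv₁ = LinearMap.id)
    (Sinv₂ : H₂ →ₗ[k] H₂)
    (hS1₂ : Sinv₂ ∘ₗ HopfAlgebra.antipode (R := k) (A := H₂) = LinearMap.id)
    (hS2₂ : HopfAlgebra.antipode (R := k) (A := H₂) ∘ₗ Sinv₂ = LinearMap.id)
    (f : H₁ →ₐ[k] H₂) (hf : Function.Surjective f)
    (hΔ : Coalgebra.comul (R := k) ∘ₗ f.toLinearMap
      = TensorProduct.map f.toLinearMap f.toLinearMap ∘ₗ Coalgebra.comul)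
    (hε : Coalgebra.counit (R := k) ∘ₗ f.toLinearMap = Coalgebra.counit (R := k))
    (n : ℕ) (hn : 0 < n) (hexp : hopfExponent k H₁ Sinv₁ = n) :
    hopfExponent k H₂ Sinv₂ ≠ 0 ∧ hopfExponent k H₂ Sinv₂ ∣ n := by
  have hm : hopfExponent k H₁ Sinv₁ ∈
      {n : ℕ | 0 < n ∧ expMap k H₁ Sinv₁ n = counitUnit k H₁} := by
    apply Nat.sInf_mem
    by_contra hne
    rw [Set.not_nonempty_iff_eq_empty] at hne
    rw [hopfExponent, hne, Nat.sInf_empty] at hexp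
    omega
  rw [hexp] at hm
  refine exponent_dvd Sinv₂ hS1₂ hS2₂ n hn ?_
  obtain ⟨m, rfl⟩ := Nat.exists_eq_succ_of_ne_zero hn.ne'
  have hc := comp_expMap f hΔ Sinv₁ Sinv₂ (comp_sinv f hΔ hε Sinv₁ Sinv₂ hS2₁ hS1₂) m
  have h2 := hm.2
  simp only [Nat.succ_eq_add_one] at h2 ⊢
  rw [h2] at hc
  ext y
  obtain ⟨x, rfl⟩ := hf y
  have hx : f (algebraMap k H₁ (Coalgebra.counit (R := k) x)) =
    expMap k H₂ Sinv₂ (m + 1) (f x) := LinearMap.congr_fun hc x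
  have hεx : Coalgebra.counit (R := k) (f x) = Coalgebra.counit (R := k) x :=
    LinearMap.congr_fun hε x
  rw [← hx, AlgHom.commutes, ← hεx]
  rfl

end
end

section
/- Let H be a Hopf algebra over a field k with bijective antipode, and let K ⊇ k be a field extension. Give K ⊗_k H the Hopf algebra structure over K obtained from H by extension of scalars (multiplication (a ⊗ x)(b ⊗ y) = ab ⊗ xy, comultiplication, counit and antipode extended K-linearly from those of H). Then exp(K ⊗_k H) = exp(H). -/
open TensorProduct

noncomputable section

variable (k H : Type*) [CommSemiring k] [Semiring H] [Bialgebra k H]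

section BaseChange

variable {k K H H' : Type*} [Field k] [Field K] [Algebra k K]
  [Ring H] [HopfAlgebra k H] [Ring H'] [HopfAlgebra K H']
  [Algebra k H'] [IsScalarTower k K H']

/-- The canonical `k`-linear map `H ⊗[k] H → H' ⊗[K] H'`, `x ⊗ y ↦ φ(x) ⊗ φ(y)`. -/
def pairMap (φ : H →ₐ[k] H') : H ⊗[k] H →ₗ[k] (H' ⊗[K] H') :=
  TensorProduct.lift (LinearMap.mk₂ k (fun x y => φ x ⊗ₜ[K] φ y)
    (fun x₁ x₂ y => by rw [map_add, TensorProduct.add_tmul])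
    (fun c x y => by rw [map_smul, TensorProduct.smul_tmul'])
    (fun x y₁ y₂ => by rw [map_add, TensorProduct.tmul_add])
    (fun c x y => by rw [map_smul, TensorProduct.tmul_smul]))

theorem aux_conv (φ : H →ₐ[k] H')
    (hcomul : ∀ x : H, Coalgebra.comul (R := K) (φ x) = pairMap φ (Coalgebra.comul (R := k) x))
    (f g : H →ₗ[k] H) (f' g' : H' →ₗ[K] H')
    (hf : ∀ x, f' (φ x) = φ (f x)) (hg : ∀ x, g' (φ x) = φ (g x)) (x : H) :
    conv K H' f' g' (φ x) = φ (conv k H f g x) := by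
  simp only [conv, LinearMap.comp_apply, hcomul]
  generalize Coalgebra.comul (R := k) x = t
  induction t with
  | zero => simp
  | add a b ha hb => simp only [map_add, ha, hb]
  | tmul a b => simp [pairMap, hf, hg]

theorem aux_pow (φ : H →ₐ[k] H') (f : H →ₗ[k] H) (f' : H' →ₗ[K] H')
    (hf : ∀ x, f' (φ x) = φ (f x)) (n : ℕ) (x : H) :
    (f' ^ n) (φ x) = φ ((f ^ n) x) := by
  induction n generalizing x with
  | zero => simp
  | succ n ih => simp only [pow_succ, Module.End.mul_apply, hf, ih]

theorem aux_expMap_s8 (φ : H →ₐ[k] H')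
    (hcomul : ∀ x : H, Coalgebra.comul (R := K) (φ x) = pairMap φ (Coalgebra.comul (R := k) x))
    (f : H →ₗ[k] H) (f' : H' →ₗ[K] H')
    (hf : ∀ x, f' (φ x) = φ (f x)) (n : ℕ) (x : H) :
    expMap K H' f' (n + 1) (φ x) = φ (expMap k H f (n + 1) x) := by
  induction n generalizing x with
  | zero => simp [expMap]
  | succ n ih =>
    simp only [expMap]
    refine aux_conv φ hcomul _ _ _ _ ih (aux_pow φ _ _ ?_ _) x
    intro y
    simp [hf]

/-- Extension of scalars does not change the exponent: if `H'` is the Hopf algebra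
`K ⊗[k] H` over `K ⊇ k` obtained from `H` by extending scalars (expressed here by the
`k`-algebra map `φ : H → H'` whose `K`-linear lift `K ⊗[k] H → H'` is bijective and which
intertwines the counits, comultiplications and antipodes), then `exp(K ⊗[k] H) = exp(H)`. -/
theorem hopfExponent_baseChange
    (Sinv : H →ₗ[k] H)
    (hS1 : Sinv ∘ₗ HopfAlgebra.antipode (R := k) (A := H) = LinearMap.id)
    (hS2 : HopfAlgebra.antipode (R := k) (A := H) ∘ₗ Sinv = LinearMap.id)
    (SinvK : H' →ₗ[K] H')
    (hS1K : SinvK ∘ₗ HopfAlgebra.antipode (R := K) (A := H') = LinearMap.id)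
    (hS2K : HopfAlgebra.antipode (R := K) (A := H') ∘ₗ SinvK = LinearMap.id)
    (φ : H →ₐ[k] H')
    -- `φ` identifies `H'` with `K ⊗[k] H` as a `K`-module
    (hbij : Function.Bijective (φ.toLinearMap.liftBaseChange K))
    -- the counit of `H'` extends that of `H`
    (hcounit : ∀ x : H, Coalgebra.counit (R := K) (φ x)
      = algebraMap k K (Coalgebra.counit (R := k) x))
    -- the comultiplication of `H'` extends that of `H`
    (hcomul : ∀ x : H, Coalgebra.comul (R := K) (φ x) = pairMap φ (Coalgebra.comul (R := k) x))
    -- the antipode of `H'` extends that of `H`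
    (hantipode : ∀ x : H, HopfAlgebra.antipode (R := K) (A := H') (φ x)
      = φ (HopfAlgebra.antipode (R := k) (A := H) x)) :
    hopfExponent K H' SinvK = hopfExponent k H Sinv := by
  have hSinv : ∀ x, SinvK (φ x) = φ (Sinv x) := by
    intro x
    have h1 : HopfAlgebra.antipode (R := k) (A := H) (Sinv x) = x := LinearMap.congr_fun hS2 x
    have h2 := LinearMap.congr_fun hS1K (φ (Sinv x))
    simpa [hantipode, h1] using h2
  have hinj : Function.Injective φ := by
    intro x y hxy
    have h1 : (1 : K) ⊗ₜ[k] x = (1 : K) ⊗ₜ[k] y := hbij.1 (by simpa using hxy)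
    exact Algebra.TensorProduct.includeRight_injective (R := k) (A := K) (B := H)
      (algebraMap k K).injective h1
  have hext : ∀ f g : H' →ₗ[K] H', (∀ x, f (φ x) = g (φ x)) → f = g := by
    intro f g h
    ext y
    obtain ⟨t, rfl⟩ := hbij.2 y
    induction t with
    | zero => simp
    | add a b ha hb => simp only [map_add, ha, hb]
    | tmul a b => simp [h]
  have hcu : ∀ x, counitUnit K H' (φ x) = φ (counitUnit k H x) := by
    intro x
    simp [counitUnit, hcounit, ← IsScalarTower.algebraMap_apply]
  unfold hopfExponent
  congr 1
  ext n
  simp only [Set.mem_setOf_eq]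
  refine and_congr_right fun hn => ?_
  obtain ⟨m, rfl⟩ : ∃ m, n = m + 1 := ⟨n - 1, by omega⟩
  have key := aux_expMap_s8 φ hcomul Sinv SinvK hSinv m
  constructor
  · intro h
    ext x
    apply hinj
    rw [← key, h, hcu]
  · intro h
    apply hext
    intro x
    rw [key, h, hcu]

end BaseChange

end
end

section
/- Let k be an algebraically closed field of characteristic zero and H a finite-dimensional Hopf algebra over k (so its antipode is bijective). Suppose there exist a grouplike element g ∈ H and an element x ∈ H with Δ(x) = x ⊗ 1 + g ⊗ x such that x does not lie in the k-linear span of the powers of g (i.e. x is a non-trivial 1:g skew-primitive element). Then exp(H) = ∞. -/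
open TensorProduct

noncomputable section

variable (k H : Type*) [CommSemiring k] [Semiring H] [Bialgebra k H]

section helpers

variable {K A : Type*} [Field K] [Ring A] [HopfAlgebra K A]

/-- `w` is `1:g` skew-primitive. -/
def SkewP (K : Type*) {A : Type*} [Field K] [Ring A] [HopfAlgebra K A] (g w : A) : Prop :=
  Coalgebra.comul (R := K) w = w ⊗ₜ[K] 1 + g ⊗ₜ[K] w

lemma SkewP.counit_zero {g w : A} (hg : IsGroupLikeElem K g) (hw : SkewP K g w) :
    algebraMap K A (Coalgebra.counit (R := K) w) = 0 := by
  have h := Coalgebra.rTensor_counit_comul (R := K) w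
  rw [hw] at h
  have h2 := congrArg (TensorProduct.lid K A) h
  simp [hg.counit_eq_one] at h2
  rcases h2 with h2 | h2
  · rw [h2, map_zero]
  · rw [Algebra.algebraMap_eq_smul_one, h2, smul_zero]

lemma SkewP.conj {g gi w : A} (hgi : IsGroupLikeElem K gi) (hg : IsGroupLikeElem K g)
    (h1 : g * gi = 1) (hw : SkewP K g w) : SkewP K g (g * w * gi) := by
  unfold SkewP at *
  rw [Bialgebra.comul_mul, Bialgebra.comul_mul, hw, hg.comul_eq_tmul_self, hgi.comul_eq_tmul_self]
  simp [mul_add, add_mul, h1, mul_assoc]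

lemma SkewP.antipode_eq {g gi w : A} (hg : IsGroupLikeElem K g)
    (h1 : g * gi = 1) (h2 : gi * g = 1) (hw : SkewP K g w) :
    HopfAlgebra.antipode K w = - (gi * w) := by
  have hs : HopfAlgebra.antipode K g = gi := by
    have := hg.antipode_mul_cancel
    calc _ = HopfAlgebra.antipode K g * (g * gi) := by rw [h1, mul_one]
      _ = gi := by rw [← mul_assoc, this, one_mul]
  have h := HopfAlgebra.mul_antipode_rTensor_comul_apply (R := K) w
  rw [hw.counit_zero hg, hw] at h
  simp [hs] at h
  exact eq_neg_of_add_eq_zero_left h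

lemma SkewP.antipode_antipode {g gi w : A} (hgi : IsGroupLikeElem K gi) (hg : IsGroupLikeElem K g)
    (h1 : g * gi = 1) (h2 : gi * g = 1) (hw : SkewP K g w) :
    HopfAlgebra.antipode K (HopfAlgebra.antipode K (g * w * gi)) = w := by
  rw [(hw.conj hgi hg h1).antipode_eq hg h1 h2]
  have hs : HopfAlgebra.antipode K gi = g := by
    have := hgi.antipode_mul_cancel
    calc _ = HopfAlgebra.antipode K gi * (gi * g) := by rw [h2, mul_one]
      _ = g := by rw [← mul_assoc, this, one_mul]
  have e : gi * (g * w * gi) = w * gi := by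
    rw [← mul_assoc, ← mul_assoc, h2, one_mul]
  rw [e, map_neg]
  have h := HopfAlgebra.mul_antipode_lTensor_comul_apply (R := K) (w * gi)
  rw [Bialgebra.counit_mul, map_mul (algebraMap K A), hw.counit_zero hg, Bialgebra.comul_mul, hw,
    hgi.comul_eq_tmul_self] at h
  simp [hs, add_mul, h1, h2, mul_assoc] at h
  exact (eq_neg_of_add_eq_zero_left h).symm

lemma exists_functional : ∃ f : A →ₗ[K] K, ∀ h : A, IsGroupLikeElem K h →
    (h = 1 → f h = 1) ∧ (h ≠ 1 → f h = 0) := by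
  have hv := linearIndep_groupLikeVal (R := K) (A := A)
  obtain ⟨f, hf⟩ := LinearMap.exists_extend
    ((Finsupp.lapply (R := K) (1 : GroupLike K A)) ∘ₗ (hv.repr : _ →ₗ[K] _))
  refine ⟨f, fun h hh => ?_⟩
  have hm : h ∈ Submodule.span K (Set.range (GroupLike.val (R := K) (A := A))) :=
    Submodule.subset_span ⟨⟨h, hh⟩, rfl⟩
  have e := LinearMap.congr_fun hf ⟨h, hm⟩
  have e2 := hv.repr_eq_single ⟨h, hh⟩ ⟨h, hm⟩ rfl
  simp [e2] at e
  rw [e]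
  constructor
  · intro h1
    have : (⟨h, hh⟩ : GroupLike K A) = 1 := GroupLike.val_injective h1
    rw [this]; simp
  · intro h1
    have : (⟨h, hh⟩ : GroupLike K A) ≠ 1 := fun q => h1 (congrArg GroupLike.val q)
    exact Finsupp.single_eq_of_ne' this

lemma mem_span_of_exp {g gi x : A} [CharZero K] (hgi : IsGroupLikeElem K gi)
    (hg : IsGroupLikeElem K g)
    (h1 : g * gi = 1) (h2 : gi * g = 1) (hx : SkewP K g x) (Sinv : A →ₗ[K] A)
    (hS1 : ∀ a, Sinv (HopfAlgebra.antipode K a) = a) (n : ℕ)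
    (hn : expMap K A Sinv (n + 1) = counitUnit K A) :
    x ∈ Submodule.span K (Set.range fun n : ℕ => g ^ n) := by
  classical
  set W := Submodule.span K (Set.range fun n : ℕ => g ^ n) with hW
  have hgW : ∀ i, g ^ i ∈ W := fun i => Submodule.subset_span ⟨i, rfl⟩
  have hT : ∀ w, SkewP K g w → (Sinv ∘ₗ Sinv) w = g * w * gi := by
    intro w hw
    have := hw.antipode_antipode hgi hg h1 h2
    simp only [LinearMap.comp_apply]
    conv_lhs => rw [← this]
    rw [hS1, hS1]
  have hSg : (Sinv ∘ₗ Sinv) g = g := by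
    have := hg.antipode_antipode
    simp only [LinearMap.comp_apply]
    conv_lhs => rw [← this]
    rw [hS1, hS1]
  have hS1' : (Sinv ∘ₗ Sinv) 1 = 1 := by
    have : Sinv 1 = 1 := by
      have := hS1 1
      rwa [HopfAlgebra.antipode_one] at this
    simp [this]
  have hSgn : ∀ m : ℕ, ((Sinv ∘ₗ Sinv) ^ m) g = g := by
    intro m
    induction m with
    | zero => simp
    | succ m ih => rw [pow_succ', Module.End.mul_apply, ih, hSg]
  have hS1n : ∀ m : ℕ, ((Sinv ∘ₗ Sinv) ^ m) 1 = 1 := by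
    intro m
    induction m with
    | zero => simp
    | succ m ih => rw [pow_succ', Module.End.mul_apply, ih, hS1']
  have hy : ∀ m : ℕ, SkewP K g (((Sinv ∘ₗ Sinv) ^ m) x) ∧
      ((Sinv ∘ₗ Sinv) ^ m) x = g ^ m * x * gi ^ m := by
    intro m
    induction m with
    | zero => simpa using hx
    | succ m ih =>
      rw [pow_succ', Module.End.mul_apply, hT _ ih.1]
      refine ⟨ih.1.conj hgi hg h1, ?_⟩
      rw [ih.2, pow_succ' g, pow_succ gi]
      simp only [mul_assoc]
  have hEg : ∀ m : ℕ, expMap K A Sinv (m + 1) g = g ^ (m + 1) := by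
    intro m
    induction m with
    | zero => simp [expMap]
    | succ m ih =>
      rw [expMap, conv]
      simp only [LinearMap.comp_apply, hg.comul_eq_tmul_self, TensorProduct.map_tmul,
        LinearMap.mul'_apply, ih, hSgn]
      rw [pow_succ g (m + 1)]
  have hEx : ∀ m : ℕ, expMap K A Sinv (m + 1) x =
      ∑ i ∈ Finset.range (m + 1), g ^ i * ((Sinv ∘ₗ Sinv) ^ i) x := by
    intro m
    induction m with
    | zero => simp [expMap]
    | succ m ih =>
      rw [Finset.sum_range_succ, ← ih, expMap, conv, LinearMap.comp_apply, LinearMap.comp_apply,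
        show Coalgebra.comul (R := K) x = _ from hx]
      rw [map_add, map_add, TensorProduct.map_tmul, TensorProduct.map_tmul,
        LinearMap.mul'_apply, LinearMap.mul'_apply, hS1n, hEg, mul_one]
  obtain ⟨f, hf⟩ := exists_functional (K := K) (A := A)
  let L : A →ₗ[K] A :=
    (TensorProduct.rid K A).toLinearMap ∘ₗ f.lTensor A ∘ₗ Coalgebra.comul
  have hL : ∀ i, L (g ^ i * ((Sinv ∘ₗ Sinv) ^ i) x) - (if g ^ i = 1 then x else 0) ∈ W := by
    intro i
    have e : L (g ^ i * ((Sinv ∘ₗ Sinv) ^ i) x) =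
        f (g ^ i) • (g ^ i * ((Sinv ∘ₗ Sinv) ^ i) x) +
        f (g ^ i * ((Sinv ∘ₗ Sinv) ^ i) x) • g ^ (i + 1) := by
      simp only [L, LinearMap.comp_apply]
      rw [Bialgebra.comul_mul, show Coalgebra.comul (R := K) (((Sinv ∘ₗ Sinv) ^ i) x) = _ from
        (hy i).1, (hg.pow (n := i)).comul_eq_tmul_self]
      simp [mul_add, pow_succ]
    rw [e]
    split_ifs with hi
    · have hgi1 : gi ^ i = 1 := by
        have hc : Commute g gi := by rw [Commute, SemiconjBy, h1, h2]
        have := hc.mul_pow i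
        rw [h1, hi, one_pow, one_mul] at this
        exact this.symm
      rw [(hf _ (hg.pow (n := i))).1 hi, (hy i).2, hgi1]
      simp only [hi, one_mul, mul_one, one_smul, add_sub_cancel_left]
      exact W.smul_mem _ (hgW _)
    · rw [(hf _ (hg.pow (n := i))).2 hi, zero_smul, zero_add, sub_zero]
      exact W.smul_mem _ (hgW _)
  have hsum := W.sum_mem (t := Finset.range (n + 1)) (fun i _ => hL i)
  rw [Finset.sum_sub_distrib, ← map_sum, ← hEx, hn] at hsum
  have hz : counitUnit K A x = 0 := by
    simp only [counitUnit, LinearMap.comp_apply, Algebra.linearMap_apply]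
    exact hx.counit_zero hg
  rw [hz, map_zero, zero_sub, Submodule.neg_mem_iff, ← Finset.sum_filter, Finset.sum_const,
    ← Nat.cast_smul_eq_nsmul K] at hsum
  refine (W.smul_mem_iff ?_).1 hsum
  rw [Nat.cast_ne_zero]
  exact Finset.card_ne_zero_of_mem (a := 0) (by simp)

end helpers

/-- Let `H` be a finite-dimensional Hopf algebra over an algebraically closed field of
characteristic zero containing a non-trivial `1:g` skew-primitive element `x` (that is,
`Δ(x) = x ⊗ 1 + g ⊗ x` for a grouplike `g`, and `x` is not in the span of the powers of `g`).
Then `exp(H) = ∞` (encoded as `hopfExponent = 0`). -/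
theorem hopfExponent_eq_zero_of_skewPrimitive {k H : Type*} [Field k] [IsAlgClosed k]
    [CharZero k] [Ring H] [HopfAlgebra k H] [FiniteDimensional k H]
    (Sinv : H →ₗ[k] H)
    (hS1 : Sinv ∘ₗ HopfAlgebra.antipode (R := k) (A := H) = LinearMap.id)
    (hS2 : HopfAlgebra.antipode (R := k) (A := H) ∘ₗ Sinv = LinearMap.id)
    (g : H) (hg0 : g ≠ 0) (hg : Coalgebra.comul (R := k) g = g ⊗ₜ[k] g)
    (x : H) (hx : Coalgebra.comul (R := k) x = x ⊗ₜ[k] 1 + g ⊗ₜ[k] x)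
    (hxg : x ∉ Submodule.span k (Set.range fun n : ℕ => g ^ n)) :
    hopfExponent k H Sinv = 0 := by
  have hc : Coalgebra.counit (R := k) g = 1 := by
    have h := Coalgebra.rTensor_counit_comul (R := k) g
    rw [hg] at h
    have h2 := congrArg (TensorProduct.lid k H) h
    simp at h2
    have h3 : (Coalgebra.counit (R := k) g - 1) • g = 0 := by rw [sub_smul, h2, one_smul, sub_self]
    exact sub_eq_zero.1 ((smul_eq_zero.1 h3).resolve_right hg0)
  have hG : IsGroupLikeElem k g := ⟨hc, hg⟩
  rw [hopfExponent, Nat.sInf_eq_zero]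
  right
  rw [Set.eq_empty_iff_forall_notMem]
  rintro n ⟨hn0, hn⟩
  obtain ⟨m, rfl⟩ := Nat.exists_eq_succ_of_ne_zero hn0.ne'
  exact hxg (mem_span_of_exp hG.antipode hG hG.mul_antipode_cancel hG.antipode_mul_cancel hx Sinv
    (fun a => LinearMap.congr_fun hS1 a) m hn)

end
end

section
/- Let H be a finite-dimensional Hopf algebra over a field k with bijective antipode S. Then exp(H) equals the smallest positive integer n such that m_n^{rev} ∘ (id ⊗ S² ⊗ S⁴ ⊗ ⋯ ⊗ S^{2n-2}) ∘ Δ_n = ε(·)1, where m_n^{rev}(a₁ ⊗ ⋯ ⊗ a_n) = a_n a_{n-1} ⋯ a₁ is the multiplication in reversed order (i.e. exp(H^{op}) = exp(H), where H^{op} is the Hopf algebra with opposite multiplication and antipode S^{-1}). -/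
open TensorProduct

noncomputable section

variable (k H : Type*) [CommSemiring k] [Semiring H] [Bialgebra k H]

/-- Convolution with respect to the *opposite* multiplication `mᵒᵖ(a ⊗ b) = b·a`
(so that iterating it yields `m_n^rev`, the multiplication in reversed order). -/
def convOp (f g : H →ₗ[k] H) : H →ₗ[k] H :=
  (LinearMap.mul' k H ∘ₗ (TensorProduct.comm k H H).toLinearMap)
    ∘ₗ TensorProduct.map f g ∘ₗ Coalgebra.comul

/-- `expMapOp k H S n = m_n^rev ∘ (id ⊗ S² ⊗ S⁴ ⊗ ⋯ ⊗ S^{2n-2}) ∘ Δ_n`, the analogue of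
`expMap` for the opposite Hopf algebra `H^op` (whose antipode is `S⁻¹`, with inverse `S`). -/
def expMapOp (S : H →ₗ[k] H) : ℕ → (H →ₗ[k] H)
  | 0 => 0
  | 1 => LinearMap.id
  | (n+2) => convOp k H (expMapOp S (n+1)) ((S ∘ₗ S) ^ (n+1))

/-- The exponent of `H^op`: the least `n > 0` with
`m_n^rev ∘ (id ⊗ S² ⊗ ⋯ ⊗ S^{2n-2}) ∘ Δ_n = ε(·)1` (`0` encodes `∞`). -/
def hopfExponentOp (S : H →ₗ[k] H) : ℕ :=
  sInf {n : ℕ | 0 < n ∧ expMapOp k H S n = counitUnit k H}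

section helpers

open WithConv HopfAlgebra LinearMap

variable {k H : Type*} [Field k] [Ring H] [HopfAlgebra k H]

theorem conv_eq (f g : H →ₗ[k] H) : toConv (conv k H f g) = toConv f * toConv g := rfl

/-- Composition with a multiplicative map distributes over convolution. -/
theorem comp_conv (φ f g : H →ₗ[k] H) (h : ∀ a b, φ (a * b) = φ a * φ b) :
    φ ∘ₗ conv k H f g = conv k H (φ ∘ₗ f) (φ ∘ₗ g) := by
  have : φ ∘ₗ LinearMap.mul' k H ∘ₗ TensorProduct.map f g
      = LinearMap.mul' k H ∘ₗ TensorProduct.map (φ ∘ₗ f) (φ ∘ₗ g) := by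
    ext a b
    simp [h]
  ext x
  exact LinearMap.congr_fun this (Coalgebra.comul x)

/-- Composition with an antimultiplicative map turns `convOp` into `conv`. -/
theorem comp_convOp (φ f g : H →ₗ[k] H) (h : ∀ a b, φ (a * b) = φ b * φ a) :
    φ ∘ₗ convOp k H f g = conv k H (φ ∘ₗ f) (φ ∘ₗ g) := by
  have : φ ∘ₗ (LinearMap.mul' k H ∘ₗ (TensorProduct.comm k H H).toLinearMap)
        ∘ₗ TensorProduct.map f g
      = LinearMap.mul' k H ∘ₗ TensorProduct.map (φ ∘ₗ f) (φ ∘ₗ g) := by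
    ext a b
    simp [h]
  ext x
  exact LinearMap.congr_fun this (Coalgebra.comul x)

/-- The square of the antipode. -/
def antiSq (k H : Type*) [Field k] [Ring H] [HopfAlgebra k H] : H →ₗ[k] H :=
  antipode (R := k) (A := H) ∘ₗ antipode (R := k) (A := H)

theorem sq_pow_mul (n : ℕ) (a b : H) :
    (antiSq k H ^ n) (a * b) = (antiSq k H ^ n) a * (antiSq k H ^ n) b := by
  induction n with
  | zero => simp
  | succ n ih =>
    rw [pow_succ']
    simp only [Module.End.mul_apply, ih]
    simp [antiSq, antipode_mul_antidistrib]

theorem sq_pow_one (n : ℕ) : (antiSq k H ^ n) (1 : H) = 1 := by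
  induction n with
  | zero => simp
  | succ n ih =>
    rw [pow_succ', Module.End.mul_apply, ih]
    simp [antiSq]

theorem comp_counitUnit (φ : H →ₗ[k] H) (h : φ 1 = 1) :
    φ ∘ₗ counitUnit k H = counitUnit k H := by
  ext x
  simp [counitUnit, Algebra.algebraMap_eq_smul_one, h]

theorem sq_pow_comm (n : ℕ) :
    (antiSq k H ^ n) ∘ₗ antipode (R := k) (A := H) = antipode (R := k) (A := H) ∘ₗ (antiSq k H ^ n) := by
  have : Commute (antiSq k H ^ n : Module.End k H) (antipode (R := k) (A := H) : Module.End k H) := by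
    apply Commute.pow_left
    change _ * _ = _ * _
    rfl
  exact this

theorem antipode_sq_conv (n : ℕ) :
    toConv (antipode (R := k) (A := H) ∘ₗ (antiSq k H ^ n)) * toConv (antiSq k H ^ n) = 1 := by
  have h := antipode_mul_id (R := k) (C := H)
  have h' : conv k H (antipode (R := k) (A := H)) LinearMap.id = counitUnit k H :=
    congrArg ofConv h
  have h2 := congrArg (fun f => (antiSq k H ^ n) ∘ₗ f) h'
  rw [comp_conv _ _ _ (sq_pow_mul n), comp_counitUnit _ (sq_pow_one n), sq_pow_comm] at h2
  exact congrArg toConv h2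

theorem sq_antipode_conv (n : ℕ) :
    toConv (antiSq k H ^ n) * toConv (antipode (R := k) (A := H) ∘ₗ (antiSq k H ^ n)) = 1 := by
  have h := id_mul_antipode (R := k) (C := H)
  have h' : conv k H LinearMap.id (antipode (R := k) (A := H)) = counitUnit k H :=
    congrArg ofConv h
  have h2 := congrArg (fun f => (antiSq k H ^ n) ∘ₗ f) h'
  rw [comp_conv _ _ _ (sq_pow_mul n), comp_counitUnit _ (sq_pow_one n), sq_pow_comm] at h2
  exact congrArg toConv h2

/-- `T^n * ⋯ * T * id` (convolution), where `T` is the square of the antipode. -/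
def leftProd (k H : Type*) [Field k] [Ring H] [HopfAlgebra k H] : ℕ → (H →ₗ[k] H)
  | 0 => LinearMap.id
  | (n+1) => conv k H (antiSq k H ^ (n+1)) (leftProd k H n)

theorem leftProd_succ (n : ℕ) :
    leftProd k H (n+1) = conv k H (antiSq k H ∘ₗ leftProd k H n) LinearMap.id := by
  induction n with
  | zero => simp [leftProd]
  | succ n ih =>
    have hm : ∀ a b : H, antiSq k H (a * b) = antiSq k H a * antiSq k H b := by
      simpa using sq_pow_mul (k := k) (H := H) 1
    have e2 : leftProd k H (n+1) = conv k H (antiSq k H ^ (n+1)) (leftProd k H n) := rfl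
    have e3 : leftProd k H (n+1+1) = conv k H (antiSq k H ^ (n+1+1)) (leftProd k H (n+1)) := rfl
    rw [e3]
    conv_rhs => rw [e2, comp_conv _ _ _ hm]
    conv_lhs => rw [ih]
    have e : antiSq k H ∘ₗ (antiSq k H ^ (n+1)) = antiSq k H ^ (n+1+1) := (pow_succ' _ _).symm
    rw [e]
    apply toConv_injective
    simp only [conv_eq, mul_assoc]

theorem antipode_expMapOp_mul (n : ℕ) :
    toConv (antipode (R := k) (A := H) ∘ₗ expMapOp k H (antipode (R := k) (A := H)) (n+1))
      * toConv (leftProd k H n) = 1 ∧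
    toConv (leftProd k H n) *
    toConv (antipode (R := k) (A := H) ∘ₗ expMapOp k H (antipode (R := k) (A := H)) (n+1)) = 1 := by
  induction n with
  | zero => exact ⟨antipode_mul_id, id_mul_antipode⟩
  | succ n ih =>
    have e : antipode (R := k) (A := H) ∘ₗ expMapOp k H (antipode (R := k) (A := H)) (n+1+1)
        = conv k H (antipode (R := k) (A := H) ∘ₗ expMapOp k H (antipode (R := k) (A := H)) (n+1))
          (antipode (R := k) (A := H) ∘ₗ (antiSq k H ^ (n+1))) := by
      rw [expMapOp, comp_convOp _ _ _ antipode_mul_antidistrib]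
      rfl
    rw [e, leftProd, conv_eq, conv_eq]
    constructor
    · rw [mul_assoc, ← mul_assoc (toConv (antipode (R := k) (A := H) ∘ₗ (antiSq k H ^ (n+1)))),
        antipode_sq_conv, one_mul, ih.1]
    · rw [mul_assoc, ← mul_assoc (toConv (leftProd k H n)), ih.2, one_mul, sq_antipode_conv]

theorem sq_pow_inv (Sinv : H →ₗ[k] H)
    (hS2 : antipode (R := k) (A := H) ∘ₗ Sinv = LinearMap.id) (n : ℕ) :
    (antiSq k H ^ n) ∘ₗ ((Sinv ∘ₗ Sinv) ^ n) = LinearMap.id := by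
  have h : (antiSq k H : Module.End k H) * (Sinv ∘ₗ Sinv : Module.End k H) = 1 := by
    ext x
    have := fun y => LinearMap.congr_fun hS2 y
    simp only [LinearMap.comp_apply, LinearMap.id_apply] at this
    simp [antiSq, this]
  induction n with
  | zero => rfl
  | succ n ih =>
    change (antiSq k H ^ (n+1) : Module.End k H) * ((Sinv ∘ₗ Sinv) ^ (n+1) : Module.End k H) = 1
    have ih' : (antiSq k H ^ n : Module.End k H) * ((Sinv ∘ₗ Sinv) ^ n : Module.End k H) = 1 := ih
    rw [pow_succ, pow_succ' (Sinv ∘ₗ Sinv : Module.End k H), mul_assoc,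
      ← mul_assoc (antiSq k H : Module.End k H), h, one_mul, ih']

theorem sq_pow_expMap (Sinv : H →ₗ[k] H)
    (hS2 : antipode (R := k) (A := H) ∘ₗ Sinv = LinearMap.id) (n : ℕ) :
    (antiSq k H ^ n) ∘ₗ expMap k H Sinv (n+1) = leftProd k H n := by
  induction n with
  | zero => rfl
  | succ n ih =>
    rw [leftProd_succ, expMap, comp_conv _ _ _ (sq_pow_mul _), sq_pow_inv Sinv hS2, ← ih]
    rw [pow_succ' (antiSq k H : Module.End k H)]
    rfl

theorem comp_eq_counitUnit_iff (φ ψ f : H →ₗ[k] H) (h1 : φ 1 = 1)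
    (h : ψ ∘ₗ φ = LinearMap.id) :
    φ ∘ₗ f = counitUnit k H ↔ f = counitUnit k H := by
  constructor
  · intro hf
    have hi : Function.Injective φ := fun a b hab => by
      have := congrArg ψ hab
      simpa [← LinearMap.comp_apply, h] using this
    rw [← comp_counitUnit φ h1] at hf
    ext x
    exact hi (LinearMap.congr_fun hf x)
  · rintro rfl
    exact comp_counitUnit φ h1

theorem expMapOp_iff (Sinv : H →ₗ[k] H)
    (hS1 : Sinv ∘ₗ antipode (R := k) (A := H) = LinearMap.id)
    (hS2 : antipode (R := k) (A := H) ∘ₗ Sinv = LinearMap.id) (n : ℕ) :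
    expMapOp k H (antipode (R := k) (A := H)) (n+1) = counitUnit k H ↔
      expMap k H Sinv (n+1) = counitUnit k H := by
  have hinv : ((Sinv ∘ₗ Sinv) ^ n) ∘ₗ (antiSq k H ^ n) = LinearMap.id := by
    have hb : Sinv ∘ₗ Sinv ∘ₗ antiSq k H = LinearMap.id := by
      ext x
      have := fun y => LinearMap.congr_fun hS1 y
      simp only [LinearMap.comp_apply, LinearMap.id_apply] at this
      simp [antiSq, this]
    have h : (Sinv ∘ₗ Sinv : Module.End k H) * (antiSq k H : Module.End k H) = 1 := hb
    clear hb
    induction n with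
    | zero => rfl
    | succ n ih =>
      change ((Sinv ∘ₗ Sinv) ^ (n+1) : Module.End k H) * (antiSq k H ^ (n+1) : Module.End k H) = 1
      have ih' : ((Sinv ∘ₗ Sinv) ^ n : Module.End k H) * (antiSq k H ^ n : Module.End k H) = 1 := ih
      rw [pow_succ, pow_succ' (antiSq k H : Module.End k H), mul_assoc,
        ← mul_assoc (Sinv ∘ₗ Sinv : Module.End k H), h, one_mul, ih']
  rw [← comp_eq_counitUnit_iff _ Sinv (expMapOp k H _ (n+1)) (antipode_one (R := k)) hS1,
    ← comp_eq_counitUnit_iff _ _ (expMap k H Sinv (n+1)) (sq_pow_one n) hinv,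
    sq_pow_expMap Sinv hS2]
  obtain ⟨h1, h2⟩ := antipode_expMapOp_mul (k := k) (H := H) n
  have hone : toConv (counitUnit k H) = 1 := rfl
  constructor
  · intro h
    rw [h, hone, one_mul] at h1
    exact toConv_injective h1
  · intro h
    rw [h, hone, one_mul] at h2
    exact toConv_injective h2

end helpers

/-- For a finite-dimensional Hopf algebra with bijective antipode, `exp(H^op) = exp(H)`:
the smallest `n > 0` with `m_n^rev ∘ (id ⊗ S² ⊗ ⋯ ⊗ S^{2n-2}) ∘ Δ_n = ε(·)1` equals the
exponent of `H` (with the convention that both are `0` when no such `n` exists). -/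
theorem hopfExponentOp_eq_hopfExponent {k H : Type*} [Field k] [Ring H] [HopfAlgebra k H]
    [FiniteDimensional k H]
    (Sinv : H →ₗ[k] H)
    (hS1 : Sinv ∘ₗ HopfAlgebra.antipode (R := k) (A := H) = LinearMap.id)
    (hS2 : HopfAlgebra.antipode (R := k) (A := H) ∘ₗ Sinv = LinearMap.id) :
    hopfExponentOp k H (HopfAlgebra.antipode (R := k) (A := H)) = hopfExponent k H Sinv := by
  unfold hopfExponentOp hopfExponent
  congr 1
  ext n
  cases n with
  | zero => simp
  | succ n => simp only [Set.mem_ofPred_eq, expMapOp_iff Sinv hS1 hS2 n]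


end
end

section
/- Let H be a finite-dimensional Hopf algebra over a field k with bijective antipode S. Then exp(H) equals the smallest positive integer n such that m_n ∘ (id ⊗ S² ⊗ S⁴ ⊗ ⋯ ⊗ S^{2n-2}) ∘ τ_n ∘ Δ_n = ε(·)1, where τ_n : H^{⊗n} → H^{⊗n} is the linear map reversing the order of the tensor factors (i.e. exp(H^{cop}) = exp(H), where H^{cop} is the Hopf algebra with opposite comultiplication and antipode S^{-1}). -/
open TensorProduct

noncomputable section

variable (k H : Type*) [CommSemiring k] [Semiring H] [Bialgebra k H]

/-- Convolution with respect to the *opposite* comultiplication `Δᶜᵒᵖ = τ ∘ Δ`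
(so that iterating it yields `m_n ∘ (f₁ ⊗ ⋯ ⊗ f_n) ∘ τ_n ∘ Δ_n`, where `τ_n` reverses
the order of the `n` tensor factors). -/
def convCop (f g : H →ₗ[k] H) : H →ₗ[k] H :=
  LinearMap.mul' k H ∘ₗ TensorProduct.map f g
    ∘ₗ ((TensorProduct.comm k H H).toLinearMap ∘ₗ Coalgebra.comul)

/-- `expMapCop k H S n = m_n ∘ (id ⊗ S² ⊗ S⁴ ⊗ ⋯ ⊗ S^{2n-2}) ∘ τ_n ∘ Δ_n`, the analogue of
`expMap` for the co-opposite Hopf algebra `H^cop` (whose antipode is `S⁻¹`, with inverse `S`). -/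
def expMapCop (S : H →ₗ[k] H) : ℕ → (H →ₗ[k] H)
  | 0 => 0
  | 1 => LinearMap.id
  | (n+2) => convCop k H (expMapCop S (n+1)) ((S ∘ₗ S) ^ (n+1))

/-- The exponent of `H^cop`: the least `n > 0` with
`m_n ∘ (id ⊗ S² ⊗ ⋯ ⊗ S^{2n-2}) ∘ τ_n ∘ Δ_n = ε(·)1` (`0` encodes `∞`). -/
def hopfExponentCop (S : H →ₗ[k] H) : ℕ :=
  sInf {n : ℕ | 0 < n ∧ expMapCop k H S n = counitUnit k H}

section HopfExpAux

open WithConv HopfAlgebra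

variable {k H : Type*} [Field k] [Ring H] [HopfAlgebra k H]

lemma aux_conv_assoc_s12 (f g h : H →ₗ[k] H) :
    conv k H (conv k H f g) h = conv k H f (conv k H g h) :=
  congrArg ofConv (mul_assoc (toConv f) (toConv g) (toConv h))

lemma aux_one_conv_s12 (f : H →ₗ[k] H) : conv k H (counitUnit k H) f = f :=
  congrArg ofConv (one_mul (toConv f))

lemma aux_conv_one (f : H →ₗ[k] H) : conv k H f (counitUnit k H) = f :=
  congrArg ofConv (mul_one (toConv f))

lemma aux_S_conv_id : conv k H (antipode k) LinearMap.id = counitUnit k H :=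
  congrArg ofConv (LinearMap.antipode_mul_id (R := k) (C := H))

lemma aux_comul_antipode :
    (Coalgebra.comul ∘ₗ antipode k : H →ₗ[k] H ⊗[k] H) =
      TensorProduct.map (antipode k) (antipode k) ∘ₗ
        (TensorProduct.comm k H H).toLinearMap ∘ₗ Coalgebra.comul := by
  let i1 : H →ₐ[k] H ⊗[k] H := Algebra.TensorProduct.includeLeft
  let i2 : H →ₐ[k] H ⊗[k] H := Algebra.TensorProduct.includeRight
  have hd : toConv (Coalgebra.comul : H →ₗ[k] H ⊗[k] H) =
      toConv (i1.toLinearMap ∘ₗ LinearMap.id) * toConv (i2.toLinearMap ∘ₗ LinearMap.id) := by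
    have : LinearMap.mul' k (H ⊗[k] H) ∘ₗ TensorProduct.map i1.toLinearMap i2.toLinearMap
        = LinearMap.id := by
      ext a b; simp [i1, i2]
    rw [LinearMap.convMul_def]
    simp only [ofConv_toConv, LinearMap.comp_id]
    rw [← LinearMap.comp_assoc, this, LinearMap.id_comp]
  have hG : toConv (TensorProduct.map (antipode k) (antipode k) ∘ₗ
        (TensorProduct.comm k H H).toLinearMap ∘ₗ Coalgebra.comul : H →ₗ[k] H ⊗[k] H) =
      toConv (i2.toLinearMap ∘ₗ antipode k) * toConv (i1.toLinearMap ∘ₗ antipode k) := by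
    have : LinearMap.mul' k (H ⊗[k] H) ∘ₗ TensorProduct.map (i2.toLinearMap ∘ₗ antipode k)
        (i1.toLinearMap ∘ₗ antipode k)
        = TensorProduct.map (antipode k) (antipode k) ∘ₗ
        (TensorProduct.comm k H H).toLinearMap := by
      ext a b; simp [i1, i2]
    rw [LinearMap.convMul_def]
    exact congrArg (fun t => toConv (t ∘ₗ Coalgebra.comul)) this.symm
  have hone : ∀ i : H →ₐ[k] H ⊗[k] H,
      toConv (i.toLinearMap ∘ₗ antipode k) * toConv (i.toLinearMap ∘ₗ LinearMap.id) = 1 := by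
    intro i
    have h := LinearMap.algHom_comp_convMul_distrib i (toConv (antipode k (A := H)))
      (toConv LinearMap.id)
    rw [LinearMap.antipode_mul_id] at h
    apply ofConv_injective
    refine h.symm.trans ?_
    ext x
    simp [LinearMap.convOne_def]
  have hleft : toConv (TensorProduct.map (antipode k) (antipode k) ∘ₗ
        (TensorProduct.comm k H H).toLinearMap ∘ₗ Coalgebra.comul : H →ₗ[k] H ⊗[k] H) *
      toConv (Coalgebra.comul : H →ₗ[k] H ⊗[k] H) = 1 := by
    rw [hG, hd, mul_assoc, ← mul_assoc (toConv (i1.toLinearMap ∘ₗ antipode k)), hone, one_mul,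
      hone]
  have := left_inv_eq_right_inv hleft LinearMap.comul_right_inv
  exact (toConv_injective this).symm

lemma aux_comp_conv_s12 (h : H →ₗ[k] H) (hm : ∀ a b, h (a * b) = h a * h b) (f g : H →ₗ[k] H) :
    h ∘ₗ conv k H f g = conv k H (h ∘ₗ f) (h ∘ₗ g) := by
  have : h ∘ₗ LinearMap.mul' k H ∘ₗ TensorProduct.map f g =
      LinearMap.mul' k H ∘ₗ TensorProduct.map (h ∘ₗ f) (h ∘ₗ g) := by
    ext a b; simp [hm]
  exact congrArg (fun t => t ∘ₗ Coalgebra.comul) this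

lemma aux_comp_convCop (h : H →ₗ[k] H) (hm : ∀ a b, h (a * b) = h b * h a) (f g : H →ₗ[k] H) :
    h ∘ₗ convCop k H f g = conv k H (h ∘ₗ g) (h ∘ₗ f) := by
  have : h ∘ₗ LinearMap.mul' k H ∘ₗ TensorProduct.map f g ∘ₗ
        (TensorProduct.comm k H H).toLinearMap =
      LinearMap.mul' k H ∘ₗ TensorProduct.map (h ∘ₗ g) (h ∘ₗ f) := by
    ext a b; simp [hm]
  exact congrArg (fun t => t ∘ₗ Coalgebra.comul) this

lemma aux_conv_antipode (f g : H →ₗ[k] H) :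
    conv k H f g ∘ₗ antipode k = convCop k H (f ∘ₗ antipode k) (g ∘ₗ antipode k) := by
  unfold conv convCop
  rw [LinearMap.comp_assoc, LinearMap.comp_assoc, aux_comul_antipode, TensorProduct.map_comp]
  rfl

variable (k H) in
/-- `id * S² * ⋯ * S^{2n}`. -/
def auxY : ℕ → (H →ₗ[k] H)
  | 0 => LinearMap.id
  | (n+1) => conv k H (auxY n) ((antipode k ∘ₗ antipode k) ^ (n+1))

variable (k H) in
/-- `S^{2n} * ⋯ * S² * id`. -/
def auxZ : ℕ → (H →ₗ[k] H)
  | 0 => LinearMap.id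
  | (n+1) => conv k H ((antipode k ∘ₗ antipode k) ^ (n+1)) (auxZ n)

lemma aux_T_mul (n : ℕ) (a b : H) : ((antipode k ∘ₗ antipode k : H →ₗ[k] H) ^ n) (a * b) =
    ((antipode k ∘ₗ antipode k : H →ₗ[k] H) ^ n) a *
      ((antipode k ∘ₗ antipode k : H →ₗ[k] H) ^ n) b := by
  induction n with
  | zero => simp
  | succ n ih =>
    simp only [pow_succ', Module.End.mul_apply, ih]
    simp [antipode_mul_antidistrib]

lemma aux_T_unit (n : ℕ) : ((antipode k ∘ₗ antipode k : H →ₗ[k] H) ^ n) ∘ₗ counitUnit k H =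
    counitUnit k H := by
  induction n with
  | zero => rfl
  | succ n ih =>
    rw [pow_succ, Module.End.mul_eq_comp, LinearMap.comp_assoc]
    have : (antipode k ∘ₗ antipode k : H →ₗ[k] H) ∘ₗ counitUnit k H = counitUnit k H := by
      ext x; simp [counitUnit, Algebra.algebraMap_eq_smul_one]
    rw [this, ih]

lemma aux_Z_shift (n : ℕ) : auxZ k H (n+1) =
    conv k H ((antipode k ∘ₗ antipode k) ∘ₗ auxZ k H n) LinearMap.id := by
  induction n with
  | zero => simp [auxZ]
  | succ n ih =>
    have e : auxZ k H (n+1) = conv k H ((antipode k ∘ₗ antipode k) ^ (n+1)) (auxZ k H n) := rfl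
    have e2 : auxZ k H (n+1+1) =
      conv k H ((antipode k ∘ₗ antipode k) ^ (n+1+1)) (auxZ k H (n+1)) := rfl
    rw [e2]
    conv_lhs => rw [ih]
    rw [← aux_conv_assoc_s12, e,
      aux_comp_conv_s12 _ (fun a b => by simpa using aux_T_mul (k := k) 1 a b), pow_succ' _ (n+1)]
    rfl

lemma aux_SQ_Y (n : ℕ) :
    conv k H (antipode k ∘ₗ expMapCop k H (antipode k) (n+1)) (auxY k H n) = counitUnit k H := by
  induction n with
  | zero => exact aux_S_conv_id
  | succ n ih =>
    have e1 : expMapCop k H (antipode k) (n+1+1) = convCop k H (expMapCop k H (antipode k) (n+1))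
      ((antipode k ∘ₗ antipode k) ^ (n+1)) := rfl
    have e2 : auxY k H (n+1) = conv k H (auxY k H n) ((antipode k ∘ₗ antipode k) ^ (n+1)) := rfl
    rw [e1, e2, aux_comp_convCop _ antipode_mul_antidistrib, aux_conv_assoc_s12,
      ← aux_conv_assoc_s12 (antipode k ∘ₗ expMapCop k H (antipode k) (n+1)), ih, aux_one_conv_s12]
    have hc : Commute (antipode k : Module.End k H)
        ((antipode k ∘ₗ antipode k : Module.End k H) ^ (n+1)) := by
      apply Commute.pow_right
      rfl
    have hc' : antipode k ∘ₗ ((antipode k ∘ₗ antipode k : Module.End k H) ^ (n+1)) =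
      ((antipode k ∘ₗ antipode k : Module.End k H) ^ (n+1)) ∘ₗ antipode k := hc
    have h := aux_comp_conv_s12 ((antipode k ∘ₗ antipode k : Module.End k H) ^ (n+1))
      (aux_T_mul (n+1)) (antipode k) LinearMap.id
    rw [aux_S_conv_id, aux_T_unit, LinearMap.comp_id] at h
    rw [hc', ← h]

lemma aux_TP (Sinv : H →ₗ[k] H)
    (hS2 : HopfAlgebra.antipode (R := k) (A := H) ∘ₗ Sinv = LinearMap.id) (n : ℕ) :
    ((antipode k ∘ₗ antipode k : Module.End k H) ^ n) ∘ₗ expMap k H Sinv (n+1) = auxZ k H n := by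
  have hTU : ∀ m : ℕ, ((antipode k ∘ₗ antipode k : Module.End k H) ^ m) ∘ₗ
      ((Sinv ∘ₗ Sinv : Module.End k H) ^ m) = LinearMap.id := by
    intro m
    induction m with
    | zero => rfl
    | succ m ih =>
      have h1 : (antipode k ∘ₗ antipode k : Module.End k H) * (Sinv ∘ₗ Sinv) = 1 := by
        ext x
        have := fun y => LinearMap.congr_fun hS2 y
        simp at this
        simp [this]
      rw [pow_succ, pow_succ', ← Module.End.mul_eq_comp, mul_assoc, ← mul_assoc _ _ (_ ^ m), h1,
        one_mul]
      exact ih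
  induction n with
  | zero => rfl
  | succ n ih =>
    have e1 : expMap k H Sinv (n+1+1) =
      conv k H (expMap k H Sinv (n+1)) ((Sinv ∘ₗ Sinv) ^ (n+1)) := rfl
    rw [e1, aux_comp_conv_s12 _ (aux_T_mul (n+1)), hTU, aux_Z_shift, ← ih, pow_succ']
    rfl

lemma aux_conj_Y (Sinv : H →ₗ[k] H)
    (hS1 : Sinv ∘ₗ HopfAlgebra.antipode (R := k) (A := H) = LinearMap.id)
    (hS2 : HopfAlgebra.antipode (R := k) (A := H) ∘ₗ Sinv = LinearMap.id) (n : ℕ) :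
    Sinv ∘ₗ auxY k H n ∘ₗ antipode k = auxZ k H n := by
  have h1 : ∀ y, Sinv (antipode k y) = y := fun y => LinearMap.congr_fun hS1 y
  have h2 : ∀ y, antipode k (Sinv y) = y := fun y => LinearMap.congr_fun hS2 y
  have hm : ∀ a b, Sinv (a * b) = Sinv b * Sinv a := by
    intro a b
    conv_lhs => rw [← h2 a, ← h2 b, ← antipode_mul_antidistrib, h1]
  induction n with
  | zero => exact hS1
  | succ n ih =>
    have e2 : auxY k H (n+1) = conv k H (auxY k H n) ((antipode k ∘ₗ antipode k) ^ (n+1)) := rfl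
    rw [e2, aux_conv_antipode, aux_comp_convCop _ hm, ih]
    have hc : Commute (antipode k : Module.End k H)
        ((antipode k ∘ₗ antipode k : Module.End k H) ^ (n+1)) := by
      apply Commute.pow_right
      rfl
    have hc' : antipode k ∘ₗ ((antipode k ∘ₗ antipode k : Module.End k H) ^ (n+1)) =
      ((antipode k ∘ₗ antipode k : Module.End k H) ^ (n+1)) ∘ₗ antipode k := hc
    rw [← hc', ← LinearMap.comp_assoc, hS1, LinearMap.id_comp]
    rfl

lemma aux_iff (Sinv : H →ₗ[k] H)
    (hS1 : Sinv ∘ₗ HopfAlgebra.antipode (R := k) (A := H) = LinearMap.id)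
    (hS2 : HopfAlgebra.antipode (R := k) (A := H) ∘ₗ Sinv = LinearMap.id) (n : ℕ) :
    expMapCop k H (antipode k) (n+1) = counitUnit k H ↔
      expMap k H Sinv (n+1) = counitUnit k H := by
  have h1 : ∀ y, Sinv (antipode k y) = y := fun y => LinearMap.congr_fun hS1 y
  have h2 : ∀ y, antipode k (Sinv y) = y := fun y => LinearMap.congr_fun hS2 y
  have hinj : Function.Injective (antipode k : H →ₗ[k] H) := Function.LeftInverse.injective h1
  have hTinj : Function.Injective ((antipode k ∘ₗ antipode k : Module.End k H) ^ n) := by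
    rw [Module.End.coe_pow]
    exact (hinj.comp hinj).iterate n
  have hSu : antipode k ∘ₗ counitUnit k H = counitUnit k H := by
    ext x; simp [counitUnit, Algebra.algebraMap_eq_smul_one]
  have huS : counitUnit k H ∘ₗ antipode k = counitUnit k H := by
    ext x; simp [counitUnit]
  have hSiu : Sinv ∘ₗ counitUnit k H = counitUnit k H := by
    rw [← hSu, ← LinearMap.comp_assoc, hS1, LinearMap.id_comp, hSu]
  have hXY := aux_SQ_Y (k := k) (H := H) n
  have hP := aux_TP Sinv hS2 n
  have hZ := aux_conj_Y Sinv hS1 hS2 n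
  have s1 : expMapCop k H (antipode k) (n+1) = counitUnit k H ↔ auxY k H n = counitUnit k H := by
    constructor
    · intro h
      rwa [h, hSu, aux_one_conv_s12] at hXY
    · intro h
      rw [h, aux_conv_one] at hXY
      rw [← LinearMap.id_comp (expMapCop k H (antipode k) (n+1)), ← hS1, LinearMap.comp_assoc, hXY,
        hSiu]
  have s2 : auxY k H n = counitUnit k H ↔ auxZ k H n = counitUnit k H := by
    constructor
    · intro h
      rw [← hZ, h, huS, hSiu]
    · intro h
      rw [h] at hZ
      ext x
      have := LinearMap.congr_fun hZ (Sinv x)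
      simp only [LinearMap.comp_apply, h2] at this
      have h3 := congrArg (antipode k) this
      rw [h2] at h3
      rw [h3]
      have h4 := LinearMap.congr_fun hSu (Sinv x)
      have h5 := LinearMap.congr_fun huS (Sinv x)
      simp only [LinearMap.comp_apply, h2] at h4 h5
      rw [h4, h5]
  have s3 : expMap k H Sinv (n+1) = counitUnit k H ↔ auxZ k H n = counitUnit k H := by
    rw [← hP]
    constructor
    · intro h
      rw [h, aux_T_unit]
    · intro h
      ext x
      apply hTinj
      have h3 := LinearMap.congr_fun h x
      have h4 := LinearMap.congr_fun (aux_T_unit (k := k) (H := H) n) x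
      exact h3.trans h4.symm
  rw [s1, s2, s3]

end HopfExpAux

/-- For a finite-dimensional Hopf algebra with bijective antipode, `exp(H^cop) = exp(H)`:
the smallest `n > 0` with `m_n ∘ (id ⊗ S² ⊗ ⋯ ⊗ S^{2n-2}) ∘ τ_n ∘ Δ_n = ε(·)1` equals the
exponent of `H` (with the convention that both are `0` when no such `n` exists). -/
theorem hopfExponentCop_eq_hopfExponent {k H : Type*} [Field k] [Ring H] [HopfAlgebra k H]
    [FiniteDimensional k H]
    (Sinv : H →ₗ[k] H)
    (hS1 : Sinv ∘ₗ HopfAlgebra.antipode (R := k) (A := H) = LinearMap.id)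
    (hS2 : HopfAlgebra.antipode (R := k) (A := H) ∘ₗ Sinv = LinearMap.id) :
    hopfExponentCop k H (HopfAlgebra.antipode (R := k) (A := H)) = hopfExponent k H Sinv := by
  unfold hopfExponentCop hopfExponent
  congr 1
  ext n
  cases n with
  | zero => simp
  | succ n =>
    simp only [Set.mem_setOf_eq]
    rw [aux_iff Sinv hS1 hS2 n]

end
end
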